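/- (Hilbert–Schmidt bound on the resolvent of K_Λ) Fix p > 2d. There exist s > 0 (depending on p) and C > 0 such that for all sufficiently large γ, every finite cube Λ = ([−L, L]^d ∩ ℤ^d) + i, and every E ∈ ℝ, with probability at least 1 − L^{−p}, the resolvent (E − K_Λ)⁻¹ exists and is Hilbert–Schmidt with ‖(E − K_Λ)⁻¹‖_{HS} ≤ C·|Λ|^s·λ·(2d+γ)/ω. -/

import Mathlib

open MeasureTheory Finset
open scoped NNReal ENNReal

noncomputable section

/-- Sites of the lattice `ℤ^d`. -/
abbrev Site (d : ℕ) := Fin d → ℤ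

/-- The `ℓ¹`-norm `|i|` of a lattice site. -/
def l1 {d : ℕ} (i : Site d) : ℕ := ∑ k, (i k).natAbs

/-- The `k`-th unit coordinate vector in `ℤ^d`. -/
def unitVec {d : ℕ} (k : Fin d) : Site d := fun l => if l = k then 1 else 0

/-- `P` is the product measure `∏_{j ∈ ℤ^d} g(dv_j)` on `Ω = ℝ^{ℤ^d}`: it is a probability
measure whose finite-dimensional cylinder marginals are products of copies of `g`. -/
def IsProductMeasure {d : ℕ} (g : Measure ℝ) (P : Measure (Site d → ℝ)) : Prop :=
  IsProbabilityMeasure P ∧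
    ∀ (s : Finset (Site d)) (A : Site d → Set ℝ), (∀ j, MeasurableSet (A j)) →
      P {v | ∀ j ∈ s, v j ∈ A j} = ∏ j ∈ s, g (A j)

/-- The single-site distribution `g` is a probability measure supported in `[-1,1]`,
absolutely continuous with a bounded density. -/
def NiceDisorder (g : Measure ℝ) : Prop :=
  IsProbabilityMeasure g ∧ g (Set.Icc (-1 : ℝ) 1)ᶜ = 0 ∧
    ∃ C : ℝ≥0, ∀ A : Set ℝ, g A ≤ (C : ℝ≥0∞) * volume A

/-- The finite-volume Anderson Hamiltonian `H_Λ = Δ_Λ + γ V` as a matrix on `ℓ²(Λ)`: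
`H_Λ(i,j) = 1` if `|i-j|_{ℓ¹} = 1` (both in `Λ`), plus the diagonal `γ v_i`. -/
def HMat {d : ℕ} (γ : ℝ) (v : Site d → ℝ) (Λ : Finset (Site d)) : Matrix Λ Λ ℂ :=
  fun i j => (if l1 (i.1 - j.1) = 1 then 1 else 0) +
    (if i = j then ((γ * v i.1 : ℝ) : ℂ) else 0)

/-- The cube `([-L, L]^d ∩ ℤ^d) + i` centered at `i`. -/
def cube {d : ℕ} (L : ℝ) (i : Site d) : Finset (Site d) :=
  (Fintype.piFinset fun _ => Finset.Icc (-⌊L⌋) ⌊L⌋).image (· + i)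

/-- `j` is a boundary site of `Λ`: it lies in `Λ` and has a nearest neighbor outside `Λ`. -/
def IsBoundary {d : ℕ} (Λ : Finset (Site d)) (j : Site d) : Prop :=
  j ∈ Λ ∧ ∃ j', l1 (j - j') = 1 ∧ j' ∉ Λ

/-- Formal action of the quasi-energy operator `K_Λ = (ω/i)∂_θ + Δ_Λ + γV + λcos(2πθ)W`
in the Fourier representation on `ℓ²(ℤ × Λ)` (the variable `n ∈ ℤ` is dual to `θ`):
`(K_Λψ)(n,j) = 2πnω ψ(n,j) + Σ_{|j-j'|=1} ψ(n,j') + γ v_j ψ(n,j)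
  + (λ/2) W(j) (ψ(n+1,j) + ψ(n-1,j))`. -/
def KAct {d : ℕ} (γ ω lam : ℝ) (v W : Site d → ℝ) (Λ : Finset (Site d))
    (ψ : ℤ × Λ → ℂ) (p : ℤ × Λ) : ℂ :=
  ((2 * Real.pi * p.1 * ω : ℝ) : ℂ) * ψ p
    + ∑ j : Λ, (if l1 (p.2.1 - j.1) = 1 then ψ (p.1, j) else 0)
    + ((γ * v p.2.1 : ℝ) : ℂ) * ψ p
    + ((lam / 2 * W p.2.1 : ℝ) : ℂ) * (ψ (p.1 + 1, p.2) + ψ (p.1 - 1, p.2))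

/-- `E` is an eigenvalue of `K_Λ`: there is a nonzero `ℓ²` eigenfunction. -/
def IsEigK {d : ℕ} (γ ω lam : ℝ) (v W : Site d → ℝ) (Λ : Finset (Site d))
    (E : ℝ) : Prop :=
  ∃ ψ : ℤ × Λ → ℂ, Memℓp ψ 2 ∧ ψ ≠ 0 ∧ ∀ p, KAct γ ω lam v W Λ ψ p = (E : ℂ) * ψ p

/-- The number of eigenvalues of `K_Λ` in `I`, counted with multiplicity, is at most `N`:
any linearly independent family of `ℓ²` eigenfunctions with eigenvalues in `I` has at
most `N` members. -/
def EigCountLE {d : ℕ} (γ ω lam : ℝ) (v W : Site d → ℝ) (Λ : Finset (Site d))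
    (I : Set ℝ) (N : ℝ) : Prop :=
  ∀ (m : ℕ) (ψ : Fin m → (ℤ × Λ → ℂ)) (μ : Fin m → ℝ),
    (∀ r, Memℓp (ψ r) 2 ∧ μ r ∈ I ∧
      ∀ p, KAct γ ω lam v W Λ (ψ r) p = (μ r : ℂ) * ψ r p) →
    LinearIndependent ℂ ψ → (m : ℝ) ≤ N

/-- `R` is the (two-sided, `ℓ²`) Green kernel of `E - K_Λ` in the Fourier
representation on `ℓ²(ℤ × Λ)`; its existence expresses invertibility of `E - K_Λ`
(which has discrete spectrum) and `R` is then the kernel of `(E - K_Λ)⁻¹`. -/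
def IsGreenK {d : ℕ} (γ ω lam : ℝ) (v W : Site d → ℝ) (Λ : Finset (Site d))
    (E : ℝ) (R : (ℤ × Λ) → (ℤ × Λ) → ℂ) : Prop :=
  (∀ q, Memℓp (fun p => R p q) 2) ∧ (∀ p, Memℓp (fun q => R p q) 2) ∧
  (∀ p q, (E : ℂ) * R p q - KAct γ ω lam v W Λ (fun p' => R p' q) p =
    if p = q then 1 else 0) ∧
  (∀ p q, (E : ℂ) * R p q - KAct γ ω lam v W Λ (fun q' => R p q') q =
    if p = q then 1 else 0)

/-- The integral kernel `(E - K_Λ)⁻¹(i,x;j,y)` on `ℓ²(Λ) ⊗ L²(S¹)` obtained from the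
Fourier coefficients `R` of the resolvent. -/
def GKer {d : ℕ} {Λ : Finset (Site d)} (R : (ℤ × Λ) → (ℤ × Λ) → ℂ)
    (i j : Λ) (x y : ℝ) : ℂ :=
  ∑' nm : ℤ × ℤ, R (nm.1, i) (nm.2, j) *
    Complex.exp (2 * Real.pi * Complex.I * ((nm.1 : ℂ) * x - (nm.2 : ℂ) * y))


/-- One-dimensional averaging bound for antitone functions. -/
lemma aux_one_dim (g : Measure ℝ) (hg : NiceDisorder g) (Cg : ℝ≥0)
    (hC : ∀ A : Set ℝ, g A ≤ (Cg : ℝ≥0∞) * volume A) (h : ℝ → ℝ) (hh : Antitone h)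
    (a b δ : ℝ) (hδ : 0 ≤ δ) (ha : ∀ x, a ≤ h x) (hb : ∀ x, h x ≤ b) :
    ∫⁻ x, ENNReal.ofReal (h x - h (x + δ)) ∂g ≤ ENNReal.ofReal (Cg * δ * (b - a)) := by
  have hgle : g ≤ (Cg : ℝ≥0∞) • (volume.restrict (Set.Icc (-1 : ℝ) 1)) := by
    refine Measure.le_intro fun s hs _ => ?_
    have h1 : g s ≤ g (s ∩ Set.Icc (-1) 1) := by
      calc g s ≤ g (s ∩ Set.Icc (-1) 1 ∪ (Set.Icc (-1 : ℝ) 1)ᶜ) := by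
            apply measure_mono
            intro x hx
            by_cases hx' : x ∈ Set.Icc (-1 : ℝ) 1
            · exact Or.inl ⟨hx, hx'⟩
            · exact Or.inr hx'
        _ ≤ g (s ∩ Set.Icc (-1) 1) + g (Set.Icc (-1 : ℝ) 1)ᶜ := measure_union_le _ _
        _ = _ := by rw [hg.2.1, add_zero]
    rw [Measure.smul_apply, Measure.restrict_apply hs]
    exact h1.trans (hC _)
  have hhδ : Antitone fun x => h (x + δ) := fun x y hxy => hh (by linarith)
  have hint : IntervalIntegrable (fun x => h x - h (x + δ)) volume (-1) 1 :=
    hh.intervalIntegrable.sub hhδ.intervalIntegrable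
  have hnn : ∀ x, 0 ≤ h x - h (x + δ) := fun x => sub_nonneg.2 (hh (by linarith))
  have hI : ∫ x in (-1 : ℝ)..1, (h x - h (x + δ)) ≤ δ * (b - a) := by
    rw [intervalIntegral.integral_sub hh.intervalIntegrable hhδ.intervalIntegrable,
      intervalIntegral.integral_comp_add_right]
    have e1 : ∫ x in (-1 : ℝ)..1, h x =
        (∫ x in (-1 : ℝ)..(-1 + δ), h x) + ∫ x in (-1 + δ)..1, h x :=
      (intervalIntegral.integral_add_adjacent_intervals hh.intervalIntegrable
        hh.intervalIntegrable).symm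
    have e2 : ∫ x in (-1 + δ)..(1 + δ), h x =
        (∫ x in (-1 + δ)..1, h x) + ∫ x in (1 : ℝ)..(1 + δ), h x :=
      (intervalIntegral.integral_add_adjacent_intervals hh.intervalIntegrable
        hh.intervalIntegrable).symm
    have e3 : ∫ x in (-1 : ℝ)..(-1 + δ), h x ≤ ∫ x in (-1 : ℝ)..(-1 + δ), b :=
      intervalIntegral.integral_mono_on (by linarith) hh.intervalIntegrable
        intervalIntegrable_const (fun x _ => hb x)
    have e4 : ∫ x in (1 : ℝ)..(1 + δ), a ≤ ∫ x in (1 : ℝ)..(1 + δ), h x :=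
      intervalIntegral.integral_mono_on (by linarith) intervalIntegrable_const
        hh.intervalIntegrable (fun x _ => ha x)
    simp only [intervalIntegral.integral_const, smul_eq_mul] at e3 e4
    rw [e1, e2]
    nlinarith
  calc ∫⁻ x, ENNReal.ofReal (h x - h (x + δ)) ∂g
      ≤ ∫⁻ x, ENNReal.ofReal (h x - h (x + δ))
          ∂((Cg : ℝ≥0∞) • (volume.restrict (Set.Icc (-1 : ℝ) 1))) :=
        lintegral_mono' hgle le_rfl
    _ = (Cg : ℝ≥0∞) * ∫⁻ x in Set.Icc (-1 : ℝ) 1, ENNReal.ofReal (h x - h (x + δ)) := by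
        rw [lintegral_smul_measure, smul_eq_mul]
    _ = (Cg : ℝ≥0∞) * ENNReal.ofReal (∫ x in (-1 : ℝ)..1, (h x - h (x + δ))) := by
        rw [intervalIntegral.integral_of_le (by norm_num), ← integral_Icc_eq_integral_Ioc,
          ofReal_integral_eq_lintegral_ofReal]
        · exact (intervalIntegrable_iff_integrableOn_Icc_of_le (by norm_num)).1 hint
        · exact Filter.Eventually.of_forall hnn
    _ ≤ (Cg : ℝ≥0∞) * ENNReal.ofReal (δ * (b - a)) := by gcongr
    _ = _ := by
        rw [mul_assoc, ENNReal.ofReal_mul (NNReal.coe_nonneg Cg), ENNReal.ofReal_coe_nnreal]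

/-- Stollmann type lemma: averaged variation of an antitone function under a uniform shift. -/
lemma aux_stollmann {κ : Type*} [Fintype κ] [DecidableEq κ] (g : Measure ℝ)
    (hg : NiceDisorder g) (Cg : ℝ≥0)
    (hC : ∀ A : Set ℝ, g A ≤ (Cg : ℝ≥0∞) * volume A) (F : (κ → ℝ) → ℝ) (hF : Antitone F)
    (hFm : Measurable F)
    (a b δ : ℝ) (hδ : 0 ≤ δ) (ha : ∀ x, a ≤ F x) (hb : ∀ x, F x ≤ b) (s : Finset κ) :
    ∫⁻ v, ENNReal.ofReal (F v - F (v + fun j => if j ∈ s then δ else 0))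
      ∂(Measure.pi fun _ : κ => g) ≤ (s.card : ℝ≥0∞) * ENNReal.ofReal (Cg * δ * (b - a)) := by
  have := hg.1
  induction s using Finset.induction_on with
  | empty =>
    have : (fun _ : κ => (0 : ℝ)) = 0 := rfl
    simp [this]
  | insert j s hj ih =>
    set G : (κ → ℝ) → ℝ := fun v => F (v + fun j => if j ∈ s then δ else 0) with hG
    have hGm : Measurable G := hFm.comp (by fun_prop)
    have hGa : Antitone G := fun x y hxy => hF (by gcongr)
    have key : ∀ v : κ → ℝ, F (v + fun i => if i ∈ insert j s then δ else 0)
        = G (v + Pi.single j δ) := by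
      intro v
      simp only [hG]
      congr 1
      funext i
      simp only [Pi.add_apply, Finset.mem_insert]
      by_cases hi : i = j
      · subst hi; simp [hj]
      · simp [hi]
    have hstep : ∫⁻ v, ENNReal.ofReal (G v - G (v + Pi.single j δ))
        ∂(Measure.pi fun _ : κ => g) ≤ ENNReal.ofReal (Cg * δ * (b - a)) := by
      have hm : Measurable fun v : κ → ℝ => ENNReal.ofReal (G v - G (v + Pi.single j δ)) := by
        have : Measurable fun v : κ → ℝ => G (v + Pi.single j δ) := hGm.comp (by fun_prop)
        fun_prop
      rw [lintegral_eq_lmarginal_univ (μ := fun _ : κ => g) (0 : κ → ℝ),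
        lmarginal_erase' _ hm (Finset.mem_univ j)]
      have hle : (fun x : κ → ℝ => ∫⁻ xi, ENNReal.ofReal
          (G (Function.update x j xi) - G (Function.update x j xi + Pi.single j δ)) ∂g)
          ≤ fun _ => ENNReal.ofReal (Cg * δ * (b - a)) := by
        intro x
        have := aux_one_dim g hg Cg hC (fun t => G (Function.update x j t))
          (fun t t' htt => hGa (by
            intro i
            by_cases hi : i = j
            · subst hi; simpa using htt
            · simp [hi])) a b δ hδ (fun _ => ha _) (fun _ => hb _)
        refine le_trans (le_of_eq ?_) this
        refine lintegral_congr fun t => ?_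
        congr 3
        funext i
        by_cases hi : i = j
        · subst hi; simp
        · simp [hi]
      refine (lmarginal_mono hle 0).trans ?_
      simp [lmarginal]
    have hm1 : Measurable fun v : κ → ℝ => ENNReal.ofReal (F v - G v) := by fun_prop
    calc ∫⁻ v, ENNReal.ofReal (F v - F (v + fun i => if i ∈ insert j s then δ else 0))
          ∂(Measure.pi fun _ : κ => g)
        ≤ ∫⁻ v, (ENNReal.ofReal (F v - G v) + ENNReal.ofReal (G v - G (v + Pi.single j δ)))
          ∂(Measure.pi fun _ : κ => g) := by
          apply lintegral_mono
          intro v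
          simp only
          rw [key, ← ENNReal.ofReal_add]
          · apply le_of_eq; congr 1; ring
          · refine sub_nonneg.2 (hF ?_)
            intro i; simp only [Pi.add_apply]; split_ifs <;> linarith
          · refine sub_nonneg.2 (hGa ?_)
            intro i; simp only [Pi.add_apply, Pi.single_apply]; split_ifs <;> linarith
      _ = _ := lintegral_add_left hm1 _
      _ ≤ (s.card : ℝ≥0∞) * ENNReal.ofReal (Cg * δ * (b - a))
          + ENNReal.ofReal (Cg * δ * (b - a)) := add_le_add ih hstep
      _ = _ := by rw [Finset.card_insert_of_notMem hj]; push_cast; ring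

/-- Restriction of the product measure to finitely many sites. -/
lemma aux_map {d : ℕ} (g : Measure ℝ) (hg : NiceDisorder g) (P : Measure (Site d → ℝ))
    (hP : IsProductMeasure g P) (Λ : Finset (Site d)) :
    P.map (fun v (j : Λ) => v j.1) = Measure.pi (fun _ : Λ => g) := by
  have := hg.1
  symm
  apply Measure.pi_eq
  intro s hs
  rw [Measure.map_apply (by fun_prop) (MeasurableSet.univ_pi hs)]
  have := hP.2 Λ (fun j => if h : j ∈ Λ then s ⟨j, h⟩ else Set.univ) (by
    intro j; split_ifs
    · exact hs _
    · exact MeasurableSet.univ)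
  rw [← Finset.prod_coe_sort] at this
  convert this using 2
  · ext v
    simp only [Set.mem_preimage, Set.mem_univ_pi, Set.mem_ofPred_eq, Subtype.forall]
    refine forall₂_congr fun j hj => ?_
    simp [hj]
  · simp

lemma aux_supp {d : ℕ} (g : Measure ℝ) (hg : NiceDisorder g) (P : Measure (Site d → ℝ))
    (hP : IsProductMeasure g P) (Λ : Finset (Site d)) :
    P {v | ¬ ∀ j ∈ Λ, v j ∈ Set.Icc (-1 : ℝ) 1} = 0 := by
  have : {v : Site d → ℝ | ¬ ∀ j ∈ Λ, v j ∈ Set.Icc (-1 : ℝ) 1} ⊆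
      ⋃ j ∈ Λ, {v | v j ∈ (Set.Icc (-1 : ℝ) 1)ᶜ} := by
    intro v hv
    simp only [Set.mem_ofPred_eq, not_forall] at hv
    obtain ⟨j, hj, h⟩ := hv
    simp only [Set.mem_iUnion]
    exact ⟨j, hj, h⟩
  refine measure_mono_null this ?_
  refine (measure_biUnion_null_iff (I := (Λ : Set (Site d))) Λ.countable_toSet).2 ?_
  intro j hj
  have := hP.2 {j} (fun _ => (Set.Icc (-1 : ℝ) 1)ᶜ) (fun _ => measurableSet_Icc.compl)
  simpa [hg.2.1] using this

/-- Comparison of eigenvalue counts. -/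
lemma aux_count {ι : Type*} [Fintype ι] [DecidableEq ι]
    (u w : OrthonormalBasis ι ℝ (EuclideanSpace ℝ ι)) (μ ν : ι → ℝ) (c E : ℝ)
    (h : ∀ x, ∑ k, μ k * inner ℝ (u k) x ^ 2 ≤ ∑ k, ν k * inner ℝ (w k) x ^ 2 + c * ‖x‖ ^ 2) :
    (Finset.univ.filter fun k => ν k < E).card ≤
      (Finset.univ.filter fun k => μ k < E + c).card := by
  classical
  set K1 := Finset.univ.filter fun k => ν k < E
  set K2 := Finset.univ.filter fun k => μ k < E + c
  let Y : (K1 → ℝ) →ₗ[ℝ] EuclideanSpace ℝ ι :=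
    ∑ l : K1, (LinearMap.proj l).smulRight (w l.1)
  let T : (K1 → ℝ) →ₗ[ℝ] (K2 → ℝ) :=
    LinearMap.pi fun k => (innerₛₗ ℝ (u k.1)).comp Y
  have hY : ∀ a, Y a = ∑ l : K1, a l • w l.1 := by
    intro a; simp [Y]
  have hT : Function.Injective T := by
    rw [← LinearMap.ker_eq_bot, LinearMap.ker_eq_bot']
    intro a ha
    set x := Y a with hx
    have hu : ∀ k ∈ K2, inner ℝ (u k) x = 0 := by
      intro k hk
      have := congrFun ha ⟨k, hk⟩
      simpa [T] using this
    have hw1 : ∀ l : K1, inner ℝ (w l.1) x = a l := by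
      intro l
      rw [hx, hY, inner_sum]
      simp only [inner_smul_right, orthonormal_iff_ite.1 w.orthonormal]
      rw [Finset.sum_eq_single l]
      · simp
      · intro b _ hb
        have : l.1 ≠ b.1 := fun h => hb (Subtype.ext h.symm)
        simp [this]
      · simp
    have hw2 : ∀ l, l ∉ K1 → inner ℝ (w l) x = 0 := by
      intro l hl
      rw [hx, hY, inner_sum]
      simp only [inner_smul_right, orthonormal_iff_ite.1 w.orthonormal]
      apply Finset.sum_eq_zero
      intro b _
      have : l ≠ b.1 := fun h => hl (h ▸ b.2)
      simp [this]
    have n1 : ∑ k, inner ℝ (u k) x ^ 2 = ‖x‖ ^ 2 := by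
      have := u.sum_sq_norm_inner_right x
      simpa using this
    have n2 : ∑ k, inner ℝ (w k) x ^ 2 = ‖x‖ ^ 2 := by
      have := w.sum_sq_norm_inner_right x
      simpa using this
    have l1' : (E + c) * ‖x‖ ^ 2 ≤ ∑ k, μ k * inner ℝ (u k) x ^ 2 := by
      rw [← n1, Finset.mul_sum]
      apply Finset.sum_le_sum
      intro k _
      by_cases hk : k ∈ K2
      · simp [hu k hk]
      · have : E + c ≤ μ k := by simpa [K2] using hk
        gcongr
    have l2 : ∑ k, (E - ν k) * inner ℝ (w k) x ^ 2 ≤ 0 := by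
      have := h x
      simp only [sub_mul, Finset.sum_sub_distrib, ← Finset.mul_sum, n2]
      linarith
    have l3 : ∀ k ∈ Finset.univ, 0 ≤ (E - ν k) * inner ℝ (w k) x ^ 2 := by
      intro k _
      by_cases hk : k ∈ K1
      · have : ν k < E := by simpa [K1] using hk
        have : 0 ≤ E - ν k := by linarith
        positivity
      · simp [hw2 k hk]
    have l4 := (Finset.sum_eq_zero_iff_of_nonneg l3).1
      (le_antisymm l2 (Finset.sum_nonneg l3))
    funext l
    have h5 := l4 l.1 (Finset.mem_univ _)
    have : ν l.1 < E := (Finset.mem_filter.1 l.2).2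
    rw [hw1] at h5
    have h6 : E - ν l.1 ≠ 0 := by linarith
    simpa [h6] using h5
  have := LinearMap.finrank_le_finrank_of_injective hT
  simpa using this

lemma aux_inner_eig {ι : Type*} [Fintype ι] [DecidableEq ι] (A : Matrix ι ι ℝ)
    (hA : A.IsHermitian) (k : ι) (x : EuclideanSpace ℝ ι) :
    inner ℝ (hA.eigenvectorBasis k) (WithLp.toLp 2 (A.mulVec x.ofLp)) =
      hA.eigenvalues k * inner ℝ (hA.eigenvectorBasis k) x := by
  rw [EuclideanSpace.inner_eq_star_dotProduct, EuclideanSpace.inner_eq_star_dotProduct]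
  simp only [star_trivial]
  have hT : A.transpose = A := by
    have := hA.eq
    rwa [Matrix.conjTranspose_eq_transpose_of_trivial] at this
  rw [dotProduct_comm, Matrix.dotProduct_mulVec, ← Matrix.mulVec_transpose, hT,
    hA.mulVec_eigenvectorBasis, smul_dotProduct, dotProduct_comm, smul_eq_mul]

lemma aux_quad {ι : Type*} [Fintype ι] [DecidableEq ι] (A : Matrix ι ι ℝ)
    (hA : A.IsHermitian) (x : EuclideanSpace ℝ ι) :
    ∑ k, hA.eigenvalues k * inner ℝ (hA.eigenvectorBasis k) x ^ 2 =
      x.ofLp ⬝ᵥ A.mulVec x.ofLp := by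
  have := hA.eigenvectorBasis.sum_inner_mul_inner (WithLp.toLp 2 (A.mulVec x.ofLp)) x
  rw [EuclideanSpace.inner_eq_star_dotProduct] at this
  simp only [star_trivial] at this
  rw [← this]
  refine Finset.sum_congr rfl fun k _ => ?_
  rw [real_inner_comm (hA.eigenvectorBasis k) (WithLp.toLp 2 (A.mulVec x.ofLp)), aux_inner_eig]
  ring

lemma aux_gap {ι : Type*} [Fintype ι] [DecidableEq ι] (A : Matrix ι ι ℝ)
    (hA : A.IsHermitian) (E ε : ℝ) (hε : 0 < ε) (hgap : ∀ k, ε ≤ |E - hA.eigenvalues k|)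
    (x y : ι → ℝ) (hxy : ∀ i, E * x i - A.mulVec x i = y i) :
    ε ^ 2 * ∑ i, x i ^ 2 ≤ ∑ i, y i ^ 2 := by
  set X : EuclideanSpace ℝ ι := WithLp.toLp 2 x
  set Y : EuclideanSpace ℝ ι := WithLp.toLp 2 y
  have hY : Y = E • X - WithLp.toLp 2 (A.mulVec X.ofLp) := by
    ext i; simp [X, Y, ← hxy]
  have hX2 : ∑ i, x i ^ 2 = ‖X‖ ^ 2 := by rw [EuclideanSpace.real_norm_sq_eq]
  have hY2 : ∑ i, y i ^ 2 = ‖Y‖ ^ 2 := by rw [EuclideanSpace.real_norm_sq_eq]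
  rw [hX2, hY2, ← hA.eigenvectorBasis.sum_sq_norm_inner_right X,
    ← hA.eigenvectorBasis.sum_sq_norm_inner_right Y, Finset.mul_sum]
  apply Finset.sum_le_sum
  intro k _
  rw [hY, inner_sub_right, aux_inner_eig, inner_smul_right, ← sub_mul, norm_mul, mul_pow]
  have := hgap k
  rw [Real.norm_eq_abs (E - _)]
  gcongr

/-- Symmetric matrix plus diagonal with potential. -/
def AMat {ι κ : Type*} [DecidableEq ι] (B : Matrix ι ι ℝ) (D : ι → ℝ) (π : ι → κ) (γ : ℝ)
    (v : κ → ℝ) : Matrix ι ι ℝ :=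
  B + Matrix.diagonal fun p => D p + γ * v (π p)

lemma AMat_herm {ι κ : Type*} [DecidableEq ι] (B : Matrix ι ι ℝ) (hB : B.IsHermitian)
    (D : ι → ℝ) (π : ι → κ) (γ : ℝ) (v : κ → ℝ) : (AMat B D π γ v).IsHermitian :=
  hB.add (Matrix.isHermitian_diagonal _)

/-- Number of eigenvalues below `E`. -/
def cntBelow {ι κ : Type*} [Fintype ι] [DecidableEq ι] (B : Matrix ι ι ℝ) (hB : B.IsHermitian)
    (D : ι → ℝ) (π : ι → κ) (γ : ℝ) (v : κ → ℝ) (E : ℝ) : ℕ :=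
  (Finset.univ.filter fun k => (AMat_herm B hB D π γ v).eigenvalues k < E).card

lemma AMat_quad {ι κ : Type*} [Fintype ι] [DecidableEq ι] (B : Matrix ι ι ℝ)
    (D : ι → ℝ) (π : ι → κ) (γ : ℝ) (v : κ → ℝ) (x : ι → ℝ) :
    x ⬝ᵥ (AMat B D π γ v).mulVec x =
      x ⬝ᵥ B.mulVec x + ∑ p, (D p + γ * v (π p)) * x p ^ 2 := by
  rw [AMat, Matrix.add_mulVec, dotProduct_add]
  congr 1
  simp only [dotProduct, Matrix.mulVec_diagonal]
  refine Finset.sum_congr rfl fun p _ => ?_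
  ring

lemma schur_bound {ι : Type*} [Fintype ι] [DecidableEq ι] (B : Matrix ι ι ℝ)
    (hB : B.IsHermitian) (M : ℝ) (hM : ∀ p, ∑ q, |B p q| ≤ M) (x : ι → ℝ) :
    |x ⬝ᵥ B.mulVec x| ≤ M * ∑ p, x p ^ 2 := by
  have hs : ∀ p q, B q p = B p q := fun p q => by simpa using hB.apply p q
  have e1 : ∑ p, ∑ q, |B p q| * x p ^ 2 ≤ M * ∑ p, x p ^ 2 := by
    rw [Finset.mul_sum]
    refine Finset.sum_le_sum fun p _ => ?_
    rw [← Finset.sum_mul]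
    exact mul_le_mul_of_nonneg_right (hM p) (sq_nonneg _)
  have e2 : ∑ p, ∑ q, |B p q| * x q ^ 2 = ∑ p, ∑ q, |B p q| * x p ^ 2 := by
    rw [Finset.sum_comm]
    refine Finset.sum_congr rfl fun p _ => Finset.sum_congr rfl fun q _ => ?_
    rw [hs]
  calc |x ⬝ᵥ B.mulVec x| = |∑ p, ∑ q, B p q * (x p * x q)| := by
        congr 1
        simp only [dotProduct, Matrix.mulVec, Finset.mul_sum]
        refine Finset.sum_congr rfl fun p _ => Finset.sum_congr rfl fun q _ => by ring
    _ ≤ ∑ p, ∑ q, |B p q * (x p * x q)| :=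
        (Finset.abs_sum_le_sum_abs _ _).trans
          (Finset.sum_le_sum fun p _ => Finset.abs_sum_le_sum_abs _ _)
    _ ≤ ∑ p, ∑ q, (|B p q| * x p ^ 2 + |B p q| * x q ^ 2) / 2 := by
        refine Finset.sum_le_sum fun p _ => Finset.sum_le_sum fun q _ => ?_
        rw [abs_mul, ← mul_add, mul_div_assoc]
        refine mul_le_mul_of_nonneg_left ?_ (abs_nonneg _)
        rw [abs_le]
        constructor <;> nlinarith [sq_nonneg (x p + x q), sq_nonneg (x p - x q)]
    _ = ∑ p, ∑ q, |B p q| * x p ^ 2 := by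
        simp only [← Finset.sum_div, Finset.sum_add_distrib, e2]
        ring
    _ ≤ _ := e1

lemma cnt_shift {ι κ : Type*} [Fintype ι] [DecidableEq ι] (B : Matrix ι ι ℝ)
    (hB : B.IsHermitian) (D : ι → ℝ) (π : ι → κ) (γ : ℝ) (v w : κ → ℝ) (E c : ℝ)
    (h : ∀ j, γ * w j ≤ γ * v j + c) :
    cntBelow B hB D π γ v E ≤ cntBelow B hB D π γ w (E + c) := by
  unfold cntBelow
  apply aux_count (AMat_herm B hB D π γ w).eigenvectorBasis
    (AMat_herm B hB D π γ v).eigenvectorBasis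
  intro x
  rw [aux_quad, aux_quad, AMat_quad, AMat_quad, EuclideanSpace.real_norm_sq_eq, Finset.mul_sum,
    add_assoc, ← Finset.sum_add_distrib]
  gcongr with p
  rw [← add_mul]
  have := h (π p)
  refine mul_le_mul_of_nonneg_right ?_ (sq_nonneg _)
  linarith

lemma cnt_upper {ι κ : Type*} [Fintype ι] [DecidableEq ι] (B : Matrix ι ι ℝ)
    (hB : B.IsHermitian) (D : ι → ℝ) (π : ι → κ) (γ : ℝ) (v : κ → ℝ) (E M m : ℝ)
    (hM : ∀ p, ∑ q, |B p q| ≤ M) (h : ∀ j, |γ * v j| ≤ m) :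
    cntBelow B hB D π γ v E ≤ (Finset.univ.filter fun p => D p < E + (M + m)).card := by
  unfold cntBelow
  apply aux_count (EuclideanSpace.basisFun ι ℝ) (AMat_herm B hB D π γ v).eigenvectorBasis
  intro x
  have hs := neg_le_of_abs_le (schur_bound B hB M hM x.ofLp)
  rw [aux_quad, AMat_quad, EuclideanSpace.real_norm_sq_eq]
  simp only [EuclideanSpace.basisFun_inner]
  have : ∑ p, D p * x.ofLp p ^ 2 ≤
      ∑ p, (D p + γ * v (π p)) * x.ofLp p ^ 2 + m * ∑ p, x.ofLp p ^ 2 := by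
    rw [Finset.mul_sum, ← Finset.sum_add_distrib]
    refine Finset.sum_le_sum fun p _ => ?_
    rw [← add_mul]
    refine mul_le_mul_of_nonneg_right ?_ (sq_nonneg _)
    linarith [neg_le_of_abs_le (h (π p))]
  linarith

lemma cnt_lower {ι κ : Type*} [Fintype ι] [DecidableEq ι] (B : Matrix ι ι ℝ)
    (hB : B.IsHermitian) (D : ι → ℝ) (π : ι → κ) (γ : ℝ) (v : κ → ℝ) (E M m : ℝ)
    (hM : ∀ p, ∑ q, |B p q| ≤ M) (h : ∀ j, |γ * v j| ≤ m) :
    (Finset.univ.filter fun p => D p < E - (M + m)).card ≤ cntBelow B hB D π γ v E := by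
  have : cntBelow B hB D π γ v E = cntBelow B hB D π γ v (E - (M + m) + (M + m)) := by
    rw [sub_add_cancel]
  rw [this]
  unfold cntBelow
  apply aux_count (AMat_herm B hB D π γ v).eigenvectorBasis (EuclideanSpace.basisFun ι ℝ)
  intro x
  have hs := le_of_abs_le (schur_bound B hB M hM x.ofLp)
  rw [aux_quad, AMat_quad, EuclideanSpace.real_norm_sq_eq]
  simp only [EuclideanSpace.basisFun_inner]
  have : ∑ p, (D p + γ * v (π p)) * x.ofLp p ^ 2 ≤
      ∑ p, D p * x.ofLp p ^ 2 + m * ∑ p, x.ofLp p ^ 2 := by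
    rw [Finset.mul_sum, ← Finset.sum_add_distrib]
    refine Finset.sum_le_sum fun p _ => ?_
    rw [← add_mul]
    refine mul_le_mul_of_nonneg_right ?_ (sq_nonneg _)
    linarith [le_of_abs_le (h (π p))]
  linarith

lemma cnt_mono_E {ι κ : Type*} [Fintype ι] [DecidableEq ι] (B : Matrix ι ι ℝ)
    (hB : B.IsHermitian) (D : ι → ℝ) (π : ι → κ) (γ : ℝ) (v : κ → ℝ) {E E' : ℝ} (h : E ≤ E') :
    cntBelow B hB D π γ v E ≤ cntBelow B hB D π γ v E' := by
  unfold cntBelow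
  apply Finset.card_le_card
  intro k hk
  simp only [Finset.mem_filter, Finset.mem_univ, true_and] at hk ⊢
  linarith

lemma cnt_lsc {ι κ : Type*} [Fintype ι] [DecidableEq ι] [Fintype κ] (B : Matrix ι ι ℝ)
    (hB : B.IsHermitian) (D : ι → ℝ) (π : ι → κ) (γ : ℝ) (hγ : 0 < γ) (E : ℝ) :
    LowerSemicontinuous fun v : κ → ℝ => (cntBelow B hB D π γ v E : ℝ) := by
  intro v y hy
  -- there is `η > 0` with no loss of eigenvalues
  obtain ⟨η, hη, hle⟩ : ∃ η > 0, cntBelow B hB D π γ v E ≤ cntBelow B hB D π γ v (E - η) := by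
    have h1 : ∀ k : ι, ∃ η > 0, (AMat_herm B hB D π γ v).eigenvalues k < E →
        (AMat_herm B hB D π γ v).eigenvalues k < E - η := by
      intro k
      by_cases hk : (AMat_herm B hB D π γ v).eigenvalues k < E
      · exact ⟨(E - (AMat_herm B hB D π γ v).eigenvalues k) / 2, by linarith, fun _ => by linarith⟩
      · exact ⟨1, one_pos, fun h => absurd h hk⟩
    choose f hf hf' using h1
    obtain ⟨η, hη, hη'⟩ : ∃ η > 0, ∀ k, η ≤ f k := by
      by_cases hne : Nonempty ι
      · obtain ⟨k, -, hk⟩ := Finset.exists_min_image Finset.univ f Finset.univ_nonempty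
        exact ⟨f k, hf k, fun k' => hk k' (Finset.mem_univ _)⟩
      · exact ⟨1, one_pos, fun k => absurd ⟨k⟩ hne⟩
    refine ⟨η, hη, Finset.card_le_card ?_⟩
    intro k hk
    simp only [Finset.mem_filter, Finset.mem_univ, true_and] at hk ⊢
    linarith [hf' k hk, hη' k]
  have hball : Metric.ball v (η / γ) ∈ nhds v := Metric.ball_mem_nhds _ (by positivity)
  filter_upwards [hball] with w hw
  refine lt_of_lt_of_le hy ?_
  have : cntBelow B hB D π γ v (E - η) ≤ cntBelow B hB D π γ w (E - η + η) := by
    apply cnt_shift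
    intro j
    have h1 : dist (w j) (v j) < η / γ := (dist_le_pi_dist w v j).trans_lt hw
    rw [Real.dist_eq, lt_div_iff₀ hγ] at h1
    have := le_abs_self (w j - v j)
    nlinarith
  rw [sub_add_cancel] at this
  have h2 := hle.trans this
  simp only
  exact_mod_cast h2

lemma wegner {ι κ : Type*} [Fintype ι] [DecidableEq ι] [Fintype κ] [DecidableEq κ]
    (g : Measure ℝ) (hg : NiceDisorder g) (Cg : ℝ≥0)
    (hC : ∀ A : Set ℝ, g A ≤ (Cg : ℝ≥0∞) * volume A) (B : Matrix ι ι ℝ)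
    (hB : B.IsHermitian) (D : ι → ℝ) (π : ι → κ) (γ : ℝ) (hγ : 0 < γ) (E M ε N : ℝ)
    (hε : 0 < ε) (hεγ : 2 * ε ≤ γ)
    (hM : ∀ p, ∑ q, |B p q| ≤ M)
    (hM0 : 0 ≤ M)
    (hN : ((Finset.univ.filter fun p => E + ε - (M + 2 * γ) ≤ D p ∧
      D p < E + ε + (M + 2 * γ)).card : ℝ) ≤ N) :
    ∃ S : Set (κ → ℝ), MeasurableSet S ∧
      (Measure.pi fun _ : κ => g) S ≤
        ENNReal.ofReal (Fintype.card κ * (Cg * (2 * ε / γ) * N)) ∧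
      ∀ v : κ → ℝ, (∀ j, v j ∈ Set.Icc (-1 : ℝ) 1) → v ∉ S →
        ∀ k, ε ≤ |E - (AMat_herm B hB D π γ v).eigenvalues k| := by
  set δ := 2 * ε / γ with hδ
  have hδ0 : 0 < δ := by positivity
  have hδ1 : δ ≤ 1 := by rw [hδ, div_le_one hγ]; exact hεγ
  have hγδ : γ * δ = 2 * ε := by rw [hδ]; field_simp
  set a : ℝ := (((Finset.univ.filter fun p => D p < E + ε - (M + 2 * γ)).card : ℕ) : ℝ) with ha
  set b : ℝ := (((Finset.univ.filter fun p => D p < E + ε + (M + 2 * γ)).card : ℕ) : ℝ) with hb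
  have hab : b ≤ a + N := by
    refine le_trans ?_ (add_le_add_right hN a)
    rw [ha, hb, ← Nat.cast_add, Nat.cast_le]
    refine le_trans (Finset.card_le_card ?_) (Finset.card_union_le _ _)
    intro p hp
    simp only [Finset.mem_filter, Finset.mem_univ, true_and, Finset.mem_union] at hp ⊢
    by_cases h : D p < E + ε - (M + 2 * γ)
    · exact Or.inl h
    · exact Or.inr ⟨not_lt.1 h, hp⟩
  have hab' : a ≤ b := by
    rw [ha, hb, Nat.cast_le]
    apply Finset.card_le_card
    intro p hp
    simp only [Finset.mem_filter, Finset.mem_univ, true_and] at hp ⊢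
    linarith
  set f : (κ → ℝ) → ℝ := fun v => (cntBelow B hB D π γ v (E + ε) : ℝ) with hf
  set F : (κ → ℝ) → ℝ := fun v => max a (min b (f v)) with hF
  have hfm : Measurable f := (cnt_lsc B hB D π γ hγ (E + ε)).measurable
  have hFm : Measurable F := measurable_const.max (measurable_const.min hfm)
  have hfa : Antitone f := by
    intro v w hvw
    have := cnt_shift B hB D π γ w v (E + ε) 0 (fun j => by
      have := hvw j
      nlinarith)
    rw [add_zero] at this
    simp only [hf]
    exact_mod_cast this
  have hFa : Antitone F := fun v w hvw => max_le_max le_rfl (min_le_min le_rfl (hfa hvw))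
  have hFf : ∀ v : κ → ℝ, (∀ j, |v j| ≤ 2) → F v = f v := by
    intro v hv
    have hv' : ∀ j, |γ * v j| ≤ 2 * γ := by
      intro j
      rw [abs_mul, abs_of_pos hγ]
      nlinarith [hv j]
    have h1 : f v ≤ b := by
      rw [hb, hf, Nat.cast_le]; exact cnt_upper B hB D π γ v (E + ε) M (2 * γ) hM hv'
    have h2 : a ≤ f v := by
      rw [ha, hf, Nat.cast_le]; exact cnt_lower B hB D π γ v (E + ε) M (2 * γ) hM hv'
    simp only [hF]
    rw [min_eq_right h1, max_eq_right h2]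
  have hm : Measurable fun v : κ → ℝ => ENNReal.ofReal (F v - F (v + fun _ => δ)) := by
    have : Measurable fun v : κ → ℝ => F (v + fun _ => δ) := hFm.comp (by fun_prop)
    fun_prop
  refine ⟨{v | 1 ≤ ENNReal.ofReal (F v - F (v + fun _ => δ))},
    measurableSet_le measurable_const hm, ?_, ?_⟩
  · have h1 := mul_meas_ge_le_lintegral (μ := Measure.pi fun _ : κ => g) hm 1
    rw [one_mul] at h1
    refine h1.trans ?_
    have h2 := aux_stollmann g hg Cg hC F hFa hFm a b δ hδ0.le (fun _ => le_max_left _ _)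
      (fun _ => max_le hab' (min_le_left _ _)) Finset.univ
    simp only [Finset.mem_univ, if_true] at h2
    refine h2.trans ?_
    rw [Finset.card_univ, ENNReal.ofReal_mul (Nat.cast_nonneg _), ENNReal.ofReal_natCast]
    gcongr
    linarith
  · intro v hv hvS k
    by_contra hlt
    rw [not_le, abs_lt] at hlt
    apply hvS
    have e1 : F v = f v := hFf v fun j => abs_le.2 ⟨by linarith [(hv j).1], by linarith [(hv j).2]⟩
    have e2 : F (v + fun _ => δ) = f (v + fun _ => δ) := hFf _ fun j => by
      simp only [Pi.add_apply]
      exact abs_le.2 ⟨by linarith [(hv j).1], by linarith [(hv j).2]⟩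
    have h3 := cnt_shift B hB D π γ (v + fun _ => δ) v (E + ε) (-(2 * ε)) (fun j => by
      simp only [Pi.add_apply]
      linarith [mul_add γ (v j) δ])
    have h4 : cntBelow B hB D π γ v (E + ε + -(2 * ε)) + 1 ≤ cntBelow B hB D π γ v (E + ε) := by
      unfold cntBelow
      apply Finset.card_lt_card
      rw [Finset.ssubset_iff_of_subset]
      · refine ⟨k, ?_, ?_⟩
        · simp only [Finset.mem_filter, Finset.mem_univ, true_and]; linarith
        · simp only [Finset.mem_filter, Finset.mem_univ, true_and]; linarith
      · intro k' hk
        simp only [Finset.mem_filter, Finset.mem_univ, true_and] at hk ⊢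
        linarith
    have h5 : f (v + fun _ => δ) + 1 ≤ f v := by
      simp only [hf]
      exact_mod_cast (Nat.add_le_add_right h3 1).trans h4
    change 1 ≤ ENNReal.ofReal _
    rw [e1, e2, ← ENNReal.ofReal_one]
    apply ENNReal.ofReal_le_ofReal
    linarith

lemma resolvent_bound {ι κ : Type*} [Fintype ι] [DecidableEq ι] (B : Matrix ι ι ℝ)
    (hB : B.IsHermitian) (D : ι → ℝ) (π : ι → κ) (γ : ℝ) (v : κ → ℝ) (E ε M : ℝ)
    (hε : 0 < ε) (hε1 : ε ≤ 1) (hM1 : 1 ≤ M)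
    (hM : ∀ p, ∑ q, (B q p + if q = p then γ * v (π p) else 0) ^ 2 ≤ M ^ 2)
    (hgap : ∀ k, ε ≤ |E - (AMat_herm B hB D π γ v).eigenvalues k|) :
    ∃ R : Matrix ι ι ℝ, (∀ p q, R p q = R q p) ∧
      (∀ p q, E * R p q - ∑ r, AMat B D π γ v p r * R r q = if p = q then 1 else 0) ∧
      ∀ p, ∑ q, R q p ^ 2 ≤ 5 * (M / ε) ^ 2 * (1 / (1 + (E - D p) ^ 2)) := by
  set A := AMat B D π γ v with hA
  have hAh : A.IsHermitian := AMat_herm B hB D π γ v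
  set Q : Matrix ι ι ℝ := E • (1 : Matrix ι ι ℝ) - A with hQ
  have hQv : ∀ x i, Q.mulVec x i = E * x i - A.mulVec x i := by
    intro x i
    rw [hQ, Matrix.sub_mulVec, Matrix.smul_mulVec, Matrix.one_mulVec]
    simp
  have hgap' : ∀ x : ι → ℝ, ε ^ 2 * ∑ i, x i ^ 2 ≤ ∑ i, (Q.mulVec x i) ^ 2 := fun x =>
    aux_gap A hAh E ε hε hgap x (Q.mulVec x) (fun i => (hQv x i).symm)
  have hinj : Function.Injective Q.mulVec := by
    intro x y hxy
    have h1 : Q.mulVec (x - y) = 0 := by rw [Matrix.mulVec_sub, hxy, sub_self]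
    have h2 := hgap' (x - y)
    rw [h1] at h2
    have h3 : ∑ i, (x - y) i ^ 2 ≤ 0 := by
      have : 0 < ε ^ 2 := by positivity
      simp only [Pi.zero_apply] at h2
      norm_num at h2
      by_contra hcon
      push Not at hcon
      simp only [Pi.sub_apply] at hcon
      nlinarith [mul_pos this hcon]
    have h4 := (Finset.sum_eq_zero_iff_of_nonneg (fun i _ => sq_nonneg ((x - y) i))).1
      (le_antisymm h3 (Finset.sum_nonneg fun i _ => sq_nonneg _))
    funext i
    have := h4 i (Finset.mem_univ i)
    simpa [sub_eq_zero] using this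
  have hunit : IsUnit Q := Matrix.mulVec_injective_iff_isUnit.1 hinj
  have hdet : IsUnit Q.det := (Matrix.isUnit_iff_isUnit_det Q).1 hunit
  have hQR : Q * Q⁻¹ = 1 := Matrix.mul_nonsing_inv Q hdet
  have hRQ : Q⁻¹ * Q = 1 := Matrix.nonsing_inv_mul Q hdet
  have hQt : Q.transpose = Q := by
    have h := hAh.eq
    rw [Matrix.conjTranspose_eq_transpose_of_trivial] at h
    rw [hQ, Matrix.transpose_sub, h, Matrix.transpose_smul, Matrix.transpose_one]
  have hRt : (Q⁻¹).transpose = Q⁻¹ := by rw [Matrix.transpose_nonsing_inv, hQt]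
  have hRbd : ∀ y : ι → ℝ, ∑ i, (Q⁻¹.mulVec y i) ^ 2 ≤ (∑ i, y i ^ 2) / ε ^ 2 := by
    intro y
    have := hgap' (Q⁻¹.mulVec y)
    rw [Matrix.mulVec_mulVec, hQR, Matrix.one_mulVec] at this
    rw [le_div_iff₀ (by positivity)]
    linarith
  refine ⟨Q⁻¹, ?_, ?_, ?_⟩
  · intro p q
    conv_lhs => rw [← hRt]
    rfl
  · intro p q
    have := congrFun (congrFun hQR p) q
    rw [hQ, Matrix.sub_mul, Matrix.smul_mul, Matrix.one_mul] at this
    rw [Matrix.one_apply, ← hQ] at this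
    rw [← this]
    simp [Matrix.mul_apply]
  · intro p
    -- column bound
    have c1 : ∑ q, Q⁻¹ q p ^ 2 ≤ 1 / ε ^ 2 := by
      have := hRbd (Pi.single p 1)
      simp only [Matrix.mulVec_single_one] at this
      have h2 : ∑ i, (Pi.single p (1 : ℝ) : ι → ℝ) i ^ 2 = 1 := by
        simp [Pi.single_apply]
      rw [h2] at this
      simpa using this
    set c : ι → ℝ := fun q => B q p + if q = p then γ * v (π p) else 0 with hc
    have c2 : ∀ q, (E - D p) * Q⁻¹ q p = (if q = p then 1 else 0) + Q⁻¹.mulVec c q := by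
      intro q
      have h1 : Q.mulVec (Pi.single p 1) = (E - D p) • (Pi.single p 1 : ι → ℝ) - c := by
        funext i
        rw [Matrix.mulVec_single_one]
        simp only [hQ, hA, AMat, hc, Matrix.col_apply, Matrix.sub_apply, Matrix.smul_apply,
          Matrix.one_apply, Matrix.add_apply, Matrix.diagonal_apply, smul_eq_mul, Pi.sub_apply,
          Pi.smul_apply, Pi.single_apply]
        split_ifs with h
        · subst h; ring
        · ring
      have h2 : Q⁻¹.mulVec (Q.mulVec (Pi.single p 1)) = Pi.single p 1 := by
        rw [Matrix.mulVec_mulVec, hRQ, Matrix.one_mulVec]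
      rw [h1, Matrix.mulVec_sub, Matrix.mulVec_smul, Matrix.mulVec_single_one] at h2
      have h3 := congrFun h2 q
      simp only [Pi.sub_apply, Pi.smul_apply, smul_eq_mul, Matrix.col_apply,
        Pi.single_apply] at h3
      linarith
    have c3 : (E - D p) ^ 2 * ∑ q, Q⁻¹ q p ^ 2 ≤ 2 + 2 * (M ^ 2 / ε ^ 2) := by
      calc (E - D p) ^ 2 * ∑ q, Q⁻¹ q p ^ 2
          = ∑ q, ((if q = p then 1 else 0) + Q⁻¹.mulVec c q) ^ 2 := by
            rw [Finset.mul_sum]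
            refine Finset.sum_congr rfl fun q _ => ?_
            rw [← c2]; ring
        _ ≤ ∑ q, (2 * (if q = p then 1 else 0) + 2 * Q⁻¹.mulVec c q ^ 2) := by
            refine Finset.sum_le_sum fun q _ => ?_
            split_ifs
            · nlinarith [sq_nonneg (1 - Q⁻¹.mulVec c q)]
            · nlinarith [sq_nonneg (Q⁻¹.mulVec c q)]
        _ = 2 + 2 * ∑ q, Q⁻¹.mulVec c q ^ 2 := by
            rw [Finset.sum_add_distrib, ← Finset.mul_sum, ← Finset.mul_sum]
            simp
        _ ≤ 2 + 2 * (M ^ 2 / ε ^ 2) := by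
            have h1 := hRbd c
            have h2 : (∑ i, c i ^ 2) / ε ^ 2 ≤ M ^ 2 / ε ^ 2 := by
              have := hM p
              gcongr
            linarith
    have hpos : 0 < 1 + (E - D p) ^ 2 := by positivity
    rw [mul_one_div, le_div_iff₀ hpos, div_pow]
    have h1 : 1 / ε ^ 2 ≤ M ^ 2 / ε ^ 2 := by
      gcongr
      nlinarith
    have h2 : 1 ≤ M ^ 2 / ε ^ 2 := by
      rw [one_le_div (by positivity)]
      nlinarith
    linarith [mul_add (∑ q, Q⁻¹ q p ^ 2) 1 ((E - D p) ^ 2)]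

/-- uniform bound of the sums over the frequency lattice -/
lemma lattice_sum (c : ℝ) (hc : 0 < c) : ∃ S > 0, ∀ (E : ℝ) (T : Finset ℤ),
    ∑ n ∈ T, 1 / (1 + (E - c * n) ^ 2) ≤ S := by
  have hs : Summable fun m : ℤ => 1 / (1 + (c * m / 2) ^ 2) := by
    have h0 : Summable fun m : ℤ => (4 / c ^ 2) * (1 / (m : ℝ) ^ 2) :=
      (Real.summable_one_div_int_pow.2 (by norm_num)).mul_left _
    have h1 : Summable fun m : ℤ => (4 / c ^ 2) * (1 / (m : ℝ) ^ 2) + if m = 0 then 1 else 0 :=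
      h0.add (summable_of_hasFiniteSupport (Set.Finite.subset (Set.finite_singleton 0) (by
        intro m hm
        simp only [Function.mem_support, ne_eq, ite_eq_right_iff, one_ne_zero, imp_false,
          not_not] at hm
        exact hm)))
    refine Summable.of_nonneg_of_le (fun m => by positivity) (fun m => ?_) h1
    by_cases hm : m = 0
    · subst hm; simp
    · simp only [hm, if_false, add_zero]
      have : (m : ℝ) ≠ 0 := by exact_mod_cast hm
      rw [div_mul_div_comm, mul_one]
      rw [div_le_div_iff₀ (by positivity) (by positivity)]
      nlinarith
  refine ⟨∑' m : ℤ, 1 / (1 + (c * m / 2) ^ 2) + 1, ?_, ?_⟩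
  · have : 0 ≤ ∑' m : ℤ, 1 / (1 + (c * m / 2) ^ 2) := tsum_nonneg fun m => by positivity
    linarith
  · intro E T
    set n0 := round (E / c) with hn0
    have hr : |E / c - n0| ≤ 1 / 2 := abs_sub_round (E / c)
    have hE : E = c * (E / c) := by field_simp
    have h1 : ∑ n ∈ T, 1 / (1 + (E - c * n) ^ 2) ≤
        ∑ n ∈ T, 1 / (1 + (c * ((n - n0 : ℤ) : ℝ) / 2) ^ 2) := by
      refine Finset.sum_le_sum fun n _ => ?_
      apply one_div_le_one_div_of_le (by positivity)
      have : (c * ((n - n0 : ℤ) : ℝ) / 2) ^ 2 ≤ (E - c * n) ^ 2 := by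
        rw [sq_le_sq]
        have e1 : E - c * n = c * (E / c - n) := by rw [mul_sub, ← hE]
        rw [e1, mul_div_assoc, abs_mul, abs_mul]
        refine mul_le_mul_of_nonneg_left ?_ (abs_nonneg _)
        rw [abs_div, abs_two]
        by_cases hn : n = n0
        · simp [hn]
        · have h1 : (1 : ℝ) ≤ |((n - n0 : ℤ) : ℝ)| := by
            have : 1 ≤ |n - n0| := Int.one_le_abs (sub_ne_zero.2 hn)
            rw [← Int.cast_abs]
            exact_mod_cast this
          have h2 : |((n - n0 : ℤ) : ℝ)| ≤ |E / c - n| + |E / c - n0| := by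
            push_cast
            have : (n : ℝ) - n0 = (E / c - n0) - (E / c - n) := by ring
            rw [this]
            linarith [abs_sub (E / c - n0) (E / c - n)]
          linarith
      linarith
    have h2 : ∑ n ∈ T, 1 / (1 + (c * ((n - n0 : ℤ) : ℝ) / 2) ^ 2) =
        ∑ m ∈ T.map (Equiv.subRight n0).toEmbedding, 1 / (1 + (c * (m : ℝ) / 2) ^ 2) := by
      rw [Finset.sum_map]
      rfl
    have h3 := hs.sum_le_tsum (T.map (Equiv.subRight n0).toEmbedding)
      (fun m _ => by positivity)
    rw [h2] at h1
    linarith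

lemma lattice_count (c : ℝ) (hc : 0 < c) (a b : ℝ) (hab : a ≤ b) (T : Finset ℤ) :
    ((T.filter fun n : ℤ => a ≤ c * n ∧ c * n < b).card : ℝ) ≤ (b - a) / c + 1 := by
  have h1 : (T.filter fun n : ℤ => a ≤ c * n ∧ c * n < b) ⊆ Finset.Ico ⌈a / c⌉ ⌈b / c⌉ := by
    intro n hn
    simp only [Finset.mem_filter] at hn
    rw [Finset.mem_Ico]
    constructor
    · rw [Int.ceil_le, div_le_iff₀ hc]; linarith [hn.2.1]
    · rw [Int.lt_ceil, lt_div_iff₀ hc]; linarith [hn.2.2]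
  have h2 := Finset.card_le_card h1
  rw [Int.card_Ico] at h2
  have h3 : ⌈a / c⌉ ≤ ⌈b / c⌉ := Int.ceil_mono (by gcongr)
  have h4 : (((⌈b / c⌉ - ⌈a / c⌉).toNat : ℕ) : ℝ) = (⌈b / c⌉ : ℝ) - ⌈a / c⌉ := by
    have : (((⌈b / c⌉ - ⌈a / c⌉).toNat : ℕ) : ℤ) = ⌈b / c⌉ - ⌈a / c⌉ :=
      Int.toNat_of_nonneg (by linarith)
    exact_mod_cast congrArg (fun z : ℤ => (z : ℝ)) this
  calc ((T.filter fun n : ℤ => a ≤ c * n ∧ c * n < b).card : ℝ)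
      ≤ ((⌈b / c⌉ - ⌈a / c⌉).toNat : ℕ) := by exact_mod_cast h2
    _ = (⌈b / c⌉ : ℝ) - ⌈a / c⌉ := h4
    _ ≤ b / c + 1 - a / c := by linarith [Int.ceil_lt_add_one (b / c), Int.le_ceil (a / c)]
    _ = _ := by ring

/-- off-diagonal real kernel of `K_Λ` -/
def offK {d : ℕ} (lam : ℝ) (W : Site d → ℝ) (Λ : Finset (Site d)) (p q : ℤ × Λ) : ℝ :=
  (if p.1 = q.1 ∧ l1 (p.2.1 - q.2.1) = 1 then 1 else 0) +
    (if p.2 = q.2 ∧ (q.1 = p.1 + 1 ∨ q.1 = p.1 - 1) then lam / 2 * W p.2.1 else 0)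

lemma l1_comm {d : ℕ} (i j : Site d) : l1 (i - j) = l1 (j - i) := by
  unfold l1
  refine Finset.sum_congr rfl fun k _ => ?_
  simp only [Pi.sub_apply]
  omega

lemma offK_comm {d : ℕ} (lam : ℝ) (W : Site d → ℝ) (Λ : Finset (Site d)) (p q : ℤ × Λ) :
    offK lam W Λ q p = offK lam W Λ p q := by
  unfold offK
  rw [l1_comm q.2.1 p.2.1]
  congr 1
  · simp only [eq_comm]
  · by_cases h : p.2 = q.2
    · simp only [h, true_and]
      have : (p.1 = q.1 + 1 ∨ p.1 = q.1 - 1) ↔ (q.1 = p.1 + 1 ∨ q.1 = p.1 - 1) := by omega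
      simp only [this]
    · have h' : ¬ q.2 = p.2 := fun e => h e.symm
      simp [h, h']

lemma offK_row {d : ℕ} (lam : ℝ) (hlam : 0 ≤ lam) (W : Site d → ℝ) (hW : ∀ j, |W j| ≤ 1)
    (Λ : Finset (Site d)) (T : Finset (ℤ × Λ)) (p : ℤ × Λ) :
    ∑ q ∈ T, |offK lam W Λ p q| ≤ Λ.card + lam := by
  have h1 : ∑ q ∈ T, |if p.1 = q.1 ∧ l1 (p.2.1 - q.2.1) = 1 then (1 : ℝ) else 0| ≤ Λ.card := by
    calc ∑ q ∈ T, |if p.1 = q.1 ∧ l1 (p.2.1 - q.2.1) = 1 then (1 : ℝ) else 0|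
        ≤ ∑ q ∈ T, if p.1 = q.1 then (1 : ℝ) else 0 := by
          refine Finset.sum_le_sum fun q _ => ?_
          by_cases h : p.1 = q.1
          · simp only [h, true_and, if_true]; split_ifs <;> simp
          · simp [h]
      _ = ((T.filter fun q => p.1 = q.1).card : ℝ) := by simp
      _ ≤ Λ.card := by
          have : (T.filter fun q => p.1 = q.1).card ≤ (Finset.univ : Finset Λ).card := by
            apply Finset.card_le_card_of_injOn (fun q => q.2) (fun _ _ => Finset.mem_univ _)
            intro a ha b hb hab
            have ha' := (Finset.mem_filter.1 ha).2
            have hb' := (Finset.mem_filter.1 hb).2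
            exact Prod.ext (ha'.symm.trans hb') hab
          rw [Finset.card_univ, Fintype.card_coe] at this
          exact_mod_cast this
  have h2 : ∑ q ∈ T, |if p.2 = q.2 ∧ (q.1 = p.1 + 1 ∨ q.1 = p.1 - 1) then lam / 2 * W p.2.1
      else 0| ≤ lam := by
    have hlw : |lam / 2 * W p.2.1| ≤ lam / 2 := by
      rw [abs_mul, abs_of_nonneg (by linarith)]
      nlinarith [hW p.2.1]
    calc ∑ q ∈ T, |if p.2 = q.2 ∧ (q.1 = p.1 + 1 ∨ q.1 = p.1 - 1) then lam / 2 * W p.2.1 else 0|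
        ≤ ∑ q ∈ T, if p.2 = q.2 ∧ (q.1 = p.1 + 1 ∨ q.1 = p.1 - 1) then lam / 2 else 0 := by
          refine Finset.sum_le_sum fun q _ => ?_
          split_ifs
          · exact hlw
          · simp
      _ = ((T.filter fun q => p.2 = q.2 ∧ (q.1 = p.1 + 1 ∨ q.1 = p.1 - 1)).card : ℝ)
            * (lam / 2) := by
          rw [← Finset.sum_filter, Finset.sum_const, nsmul_eq_mul]
      _ ≤ 2 * (lam / 2) := by
          have : (T.filter fun q => p.2 = q.2 ∧ (q.1 = p.1 + 1 ∨ q.1 = p.1 - 1)).card ≤ 2 := by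
            refine le_trans (Finset.card_le_card (t := {(p.1 + 1, p.2), (p.1 - 1, p.2)}) ?_)
              Finset.card_le_two
            intro q hq
            obtain ⟨h1, h2⟩ := (Finset.mem_filter.1 hq).2
            simp only [Finset.mem_insert, Finset.mem_singleton]
            rcases h2 with h2 | h2
            · exact Or.inl (Prod.ext h2 h1.symm)
            · exact Or.inr (Prod.ext h2 h1.symm)
          have : ((T.filter fun q => p.2 = q.2 ∧
              (q.1 = p.1 + 1 ∨ q.1 = p.1 - 1)).card : ℝ) ≤ 2 := by exact_mod_cast this
          exact mul_le_mul_of_nonneg_right this (by linarith)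
      _ = lam := by ring
  calc ∑ q ∈ T, |offK lam W Λ p q| ≤ ∑ q ∈ T, (|if p.1 = q.1 ∧ l1 (p.2.1 - q.2.1) = 1 then (1 : ℝ)
        else 0| + |if p.2 = q.2 ∧ (q.1 = p.1 + 1 ∨ q.1 = p.1 - 1) then lam / 2 * W p.2.1 else 0|) :=
        Finset.sum_le_sum fun q _ => abs_add_le _ _
    _ ≤ _ := by rw [Finset.sum_add_distrib]; linarith

/-- truncated index set -/
def TN {d : ℕ} (Λ : Finset (Site d)) (N : ℕ) : Finset (ℤ × Λ) :=
  Finset.Icc (-(N : ℤ)) N ×ˢ Finset.univ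

lemma KAct_eq_sum {d : ℕ} (γ ω lam : ℝ) (v W : Site d → ℝ) (Λ : Finset (Site d)) (N : ℕ)
    (p : ℤ × Λ) (hp : |p.1| + 1 ≤ N) (ψ : ℤ × Λ → ℝ) :
    KAct γ ω lam v W Λ (fun q => (ψ q : ℂ)) p =
      ((∑ q ∈ TN Λ N, (offK lam W Λ p q +
        if p = q then (2 * Real.pi * ω) * p.1 + γ * v p.2.1 else 0) * ψ q : ℝ) : ℂ) := by
  have hm : ∀ n : ℤ, |n| ≤ |p.1| + 1 → ∀ j : Λ, (n, j) ∈ TN Λ N := by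
    intro n hn j
    simp only [TN, Finset.mem_product, Finset.mem_Icc, Finset.mem_univ, and_true]
    exact abs_le.1 (hn.trans hp)
  have m0 : p ∈ TN Λ N := hm p.1 (by linarith) p.2
  have m1 : (p.1 + 1, p.2) ∈ TN Λ N := hm _ ((abs_add_le _ _).trans (by simp)) _
  have m2 : (p.1 - 1, p.2) ∈ TN Λ N := hm _ ((abs_sub _ _).trans (by simp)) _
  have s1 : ∑ q ∈ TN Λ N, (if p = q then (2 * Real.pi * ω) * p.1 + γ * v p.2.1 else 0) * ψ q =
      ((2 * Real.pi * ω) * p.1 + γ * v p.2.1) * ψ p := by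
    simp [m0]
  have s2 : ∑ q ∈ TN Λ N, (if p.1 = q.1 ∧ l1 (p.2.1 - q.2.1) = 1 then (1 : ℝ) else 0) * ψ q =
      ∑ j : Λ, if l1 (p.2.1 - j.1) = 1 then ψ (p.1, j) else 0 := by
    rw [TN, Finset.sum_product]
    rw [Finset.sum_eq_single p.1]
    · simp
    · intro n _ hn
      apply Finset.sum_eq_zero
      intro j _
      simp [hn.symm]
    · intro h
      exact absurd (Finset.mem_product.1 m0).1 h
  have s3 : ∑ q ∈ TN Λ N, (if p.2 = q.2 ∧ (q.1 = p.1 + 1 ∨ q.1 = p.1 - 1) then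
      lam / 2 * W p.2.1 else 0) * ψ q =
      lam / 2 * W p.2.1 * (ψ (p.1 + 1, p.2) + ψ (p.1 - 1, p.2)) := by
    have : ∀ q : ℤ × Λ, (if p.2 = q.2 ∧ (q.1 = p.1 + 1 ∨ q.1 = p.1 - 1) then
        lam / 2 * W p.2.1 else 0) * ψ q =
        (if (p.1 + 1, p.2) = q then lam / 2 * W p.2.1 * ψ q else 0) +
        (if (p.1 - 1, p.2) = q then lam / 2 * W p.2.1 * ψ q else 0) := by
      intro q
      obtain ⟨n, j⟩ := q
      simp only [Prod.mk.injEq]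
      by_cases hj : p.2 = j
      · by_cases h1 : n = p.1 + 1
        · have h2 : ¬ (p.1 - 1 = n) := by omega
          simp [hj, h1]
          intro h; omega
        · by_cases h2 : n = p.1 - 1
          · simp [hj, h2]
            intro h; omega
          · have h1' : ¬ (p.1 + 1 = n) := fun h => h1 h.symm
            have h2' : ¬ (p.1 - 1 = n) := fun h => h2 h.symm
            simp [h1, h2, h1', h2']
      · simp [hj]
    simp only [this, Finset.sum_add_distrib, Finset.sum_ite_eq, m1, m2, if_true]
    ring
  have : ∑ q ∈ TN Λ N, (offK lam W Λ p q +
        if p = q then (2 * Real.pi * ω) * p.1 + γ * v p.2.1 else 0) * ψ q =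
      (∑ j : Λ, if l1 (p.2.1 - j.1) = 1 then ψ (p.1, j) else 0) +
      lam / 2 * W p.2.1 * (ψ (p.1 + 1, p.2) + ψ (p.1 - 1, p.2)) +
      ((2 * Real.pi * ω) * p.1 + γ * v p.2.1) * ψ p := by
    rw [← s1, ← s2, ← s3, ← Finset.sum_add_distrib, ← Finset.sum_add_distrib]
    refine Finset.sum_congr rfl fun q _ => ?_
    rw [offK]; ring
  rw [this, KAct]
  push_cast
  have hsum : ∀ j : Λ, ((if l1 (p.2.1 - j.1) = 1 then ψ (p.1, j) else 0 : ℝ) : ℂ) =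
      if l1 (p.2.1 - j.1) = 1 then (ψ (p.1, j) : ℂ) else 0 := by
    intro j; split_ifs <;> simp
  simp only [hsum]
  ring

/-- approximate Green function -/
def ApproxGreen {d : ℕ} (γ ω lam : ℝ) (v W : Site d → ℝ) (Λ : Finset (Site d)) (E Bd : ℝ)
    (N : ℕ) (R : (ℤ × Λ) × (ℤ × Λ) → ℝ) : Prop :=
  (∀ p q, R (p, q) = R (q, p)) ∧
  (∀ p q : ℤ × Λ, |p.1| + 1 ≤ N → |q.1| ≤ N →
    (E : ℂ) * R (p, q) - KAct γ ω lam v W Λ (fun p' => (R (p', q) : ℂ)) p =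
      if p = q then 1 else 0) ∧
  ∀ F : Finset ((ℤ × Λ) × (ℤ × Λ)), ∑ q ∈ F, R q ^ 2 ≤ Bd

lemma green_limit {d : ℕ} (γ ω lam : ℝ) (v W : Site d → ℝ) (Λ : Finset (Site d)) (E Bd : ℝ)
    (h : ∃ᶠ N : ℕ in Filter.atTop, ∃ R, ApproxGreen γ ω lam v W Λ E Bd N R) :
    ∃ R : (ℤ × Λ) → (ℤ × Λ) → ℂ, IsGreenK γ ω lam v W Λ E R ∧
      Summable (fun q : (ℤ × Λ) × (ℤ × Λ) => ‖R q.1 q.2‖ ^ 2) ∧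
      ∑' q : (ℤ × Λ) × (ℤ × Λ), ‖R q.1 q.2‖ ^ 2 ≤ Bd := by
  obtain ⟨φ, hφ, hφR⟩ := Filter.extraction_of_frequently_atTop h
  choose Rn hs he hb using hφR
  have hBd : 0 ≤ Bd := by simpa using hb 0 ∅
  have hcpt : IsCompact (Set.univ.pi fun _ : (ℤ × Λ) × (ℤ × Λ) =>
      Set.Icc (-Real.sqrt Bd) (Real.sqrt Bd)) := isCompact_univ_pi fun _ => isCompact_Icc
  have hmem : ∀ n, Rn n ∈ (Set.univ.pi fun _ : (ℤ × Λ) × (ℤ × Λ) =>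
      Set.Icc (-Real.sqrt Bd) (Real.sqrt Bd)) := by
    intro n q _
    have := hb n {q}
    rw [Finset.sum_singleton] at this
    exact abs_le.1 (Real.abs_le_sqrt this)
  obtain ⟨R, -, θ, hθ, hlim⟩ := hcpt.tendsto_subseq hmem
  have hpt : ∀ q, Filter.Tendsto (fun n => Rn (θ n) q) Filter.atTop (nhds (R q)) := fun q =>
    (tendsto_pi_nhds.1 hlim q)
  have hN : Filter.Tendsto (fun n => φ (θ n)) Filter.atTop Filter.atTop :=
    hφ.tendsto_atTop.comp hθ.tendsto_atTop
  have hsym : ∀ p q, R (p, q) = R (q, p) := by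
    intro p q
    refine tendsto_nhds_unique (hpt (p, q)) ?_
    simp only [hs _ p q]
    exact hpt (q, p)
  have heq : ∀ p q : ℤ × Λ,
      (E : ℂ) * R (p, q) - KAct γ ω lam v W Λ (fun p' => (R (p', q) : ℂ)) p =
      if p = q then 1 else 0 := by
    intro p q
    have hcont : Continuous fun R : (ℤ × Λ) × (ℤ × Λ) → ℝ =>
        (E : ℂ) * R (p, q) - KAct γ ω lam v W Λ (fun p' => (R (p', q) : ℂ)) p := by
      unfold KAct
      have hj : ∀ j : Λ, Continuous fun R : (ℤ × Λ) × (ℤ × Λ) → ℝ =>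
          if l1 (p.2.1 - j.1) = 1 then (R ((p.1, j), q) : ℂ) else 0 := by
        intro j
        split_ifs <;> fun_prop
      have hj2 := continuous_finsetSum Finset.univ fun j _ => hj j
      fun_prop
    refine tendsto_nhds_unique ((hcont.tendsto R).comp hlim) ?_
    refine tendsto_const_nhds.congr' ?_
    filter_upwards [hN.eventually_ge_atTop (|p.1| + 1 + |q.1|).toNat] with n hn
    have h1 : |p.1| + 1 + |q.1| ≤ (φ (θ n) : ℤ) := by
      have := Int.self_le_toNat (|p.1| + 1 + |q.1|)
      omega
    exact (he (θ n) p q (by linarith [abs_nonneg q.1]) (by linarith [abs_nonneg p.1])).symm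
  have hsumle : ∀ F : Finset ((ℤ × Λ) × (ℤ × Λ)), ∑ q ∈ F, R q ^ 2 ≤ Bd := by
    intro F
    refine le_of_tendsto (tendsto_finsetSum F fun q _ => (hpt q).pow 2) ?_
    exact Filter.Eventually.of_forall fun n => hb _ F
  have hsummable : Summable fun q => R q ^ 2 :=
    summable_of_sum_le (fun q => sq_nonneg _) hsumle
  have hnorm : ∀ q : (ℤ × Λ) × (ℤ × Λ), ‖(R (q.1, q.2) : ℂ)‖ ^ 2 = R q ^ 2 := by
    intro q; simp
  have hmem2 : ∀ q, Memℓp (fun p => (R (p, q) : ℂ)) 2 := by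
    intro q
    apply memℓp_gen
    have : Summable fun p => R (p, q) ^ 2 :=
      hsummable.comp_injective (i := fun p => (p, q)) fun a b hab => (Prod.mk.inj hab).1
    simpa using this
  refine ⟨fun p q => (R (p, q) : ℂ), ⟨hmem2, ?_, heq, ?_⟩, ?_, ?_⟩
  · intro p
    simpa only [hsym p] using hmem2 p
  · intro p q
    simp only [hsym p]
    rw [heq q p]
    simp only [eq_comm]
  · simpa only [hnorm] using hsummable
  · simp only [hnorm]
    exact hsummable.tsum_le_of_sum_le hsumle

/-- truncated off-diagonal matrix -/
def BN {d : ℕ} (lam : ℝ) (W : Site d → ℝ) (Λ : Finset (Site d)) (N : ℕ) :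
    Matrix (TN Λ N) (TN Λ N) ℝ :=
  Matrix.of fun p q => offK lam W Λ p.1 q.1

lemma BN_herm {d : ℕ} (lam : ℝ) (W : Site d → ℝ) (Λ : Finset (Site d)) (N : ℕ) :
    (BN lam W Λ N).IsHermitian := by
  ext p q
  simp only [BN, Matrix.conjTranspose_apply, Matrix.of_apply, star_trivial]
  exact offK_comm lam W Λ p.1 q.1

lemma BN_row {d : ℕ} (lam : ℝ) (hlam : 0 ≤ lam) (W : Site d → ℝ) (hW : ∀ j, |W j| ≤ 1)
    (Λ : Finset (Site d)) (N : ℕ) (p : TN Λ N) :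
    ∑ q, |BN lam W Λ N p q| ≤ Λ.card + lam := by
  refine le_trans (le_of_eq ?_) (offK_row lam hlam W hW Λ (TN Λ N) p.1)
  exact Finset.sum_coe_sort (TN Λ N) (fun q => |offK lam W Λ p.1 q|)

/-- spectral gap of the truncated operator -/
def GapN {d : ℕ} (γ ω lam : ℝ) (W : Site d → ℝ) (Λ : Finset (Site d)) (E ε : ℝ) (N : ℕ)
    (v : Λ → ℝ) : Prop :=
  ∀ k, ε ≤ |E - (AMat_herm (BN lam W Λ N) (BN_herm lam W Λ N)
    (fun p : TN Λ N => (2 * Real.pi * ω) * (p.1.1 : ℝ)) (fun p => p.1.2) γ v).eigenvalues k|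

lemma approx_of_gap {d : ℕ} (γ ω lam : ℝ) (hγ : 1 ≤ γ) (hlam : 0 ≤ lam)
    (v W : Site d → ℝ) (hW : ∀ j, |W j| ≤ 1) (Λ : Finset (Site d)) (E ε S : ℝ) (N : ℕ)
    (hε : 0 < ε) (hε1 : ε ≤ 1) (hv : ∀ j ∈ Λ, v j ∈ Set.Icc (-1 : ℝ) 1)
    (hS : ∀ T : Finset ℤ, ∑ n ∈ T, 1 / (1 + (E - (2 * Real.pi * ω) * n) ^ 2) ≤ S)
    (hgap : GapN γ ω lam W Λ E ε N (fun j => v j.1)) :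
    ∃ R, ApproxGreen γ ω lam v W Λ E
      (5 * ((Λ.card + lam + γ) / ε) ^ 2 * (Λ.card * S)) N R := by
  obtain ⟨R, hRs, hRe, hRb⟩ := resolvent_bound (BN lam W Λ N) (BN_herm lam W Λ N)
    (fun p : TN Λ N => (2 * Real.pi * ω) * (p.1.1 : ℝ)) (fun p => p.1.2) γ (fun j => v j.1)
    E ε (Λ.card + lam + γ) hε hε1
    (by have : (0 : ℝ) ≤ Λ.card := Nat.cast_nonneg _
        linarith) (by
      intro p
      have hnn : ∀ q ∈ (Finset.univ : Finset (TN Λ N)),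
          0 ≤ |BN lam W Λ N q p + if q = p then γ * v p.1.2.1 else 0| := fun q _ => abs_nonneg _
      have h1 := Finset.sum_sq_le_sq_sum_of_nonneg hnn
      simp only [sq_abs] at h1
      refine h1.trans ?_
      refine pow_le_pow_left₀ (Finset.sum_nonneg hnn) ?_ 2
      calc ∑ q, |BN lam W Λ N q p + if q = p then γ * v p.1.2.1 else 0|
          ≤ ∑ q, (|BN lam W Λ N p q| + if q = p then γ else 0) := by
            refine Finset.sum_le_sum fun q _ => ?_
            refine (abs_add_le _ _).trans ?_
            have e : BN lam W Λ N q p = BN lam W Λ N p q := offK_comm lam W Λ p.1 q.1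
            rw [e]
            refine add_le_add le_rfl ?_
            split_ifs
            · have := hv p.1.2.1 p.1.2.2
              have h2 : |v p.1.2.1| ≤ 1 := abs_le.2 this
              rw [abs_mul, abs_of_nonneg (by linarith)]
              nlinarith
            · simp
        _ ≤ _ := by
            rw [Finset.sum_add_distrib]
            have := BN_row lam hlam W hW Λ N p
            simp only [Finset.sum_ite_eq', Finset.mem_univ, if_true]
            linarith) hgap
  set Rt : (ℤ × Λ) × (ℤ × Λ) → ℝ := fun pq =>
    if h : pq.1 ∈ TN Λ N ∧ pq.2 ∈ TN Λ N then R ⟨pq.1, h.1⟩ ⟨pq.2, h.2⟩ else 0 with hRt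
  have hval : ∀ p q : TN Λ N, Rt (p.1, q.1) = R p q := by
    intro p q
    simp [hRt]
  have hz : ∀ pq, pq ∉ TN Λ N ×ˢ TN Λ N → Rt pq = 0 := by
    intro pq h
    rw [Finset.mem_product] at h
    simp only [hRt, h, dif_neg, not_false_eq_true]
  have hmemT : ∀ p : ℤ × Λ, |p.1| ≤ N → p ∈ TN Λ N := by
    intro p hp
    simp only [TN, Finset.mem_product, Finset.mem_Icc, Finset.mem_univ, and_true]
    exact abs_le.1 hp
  refine ⟨Rt, ?_, ?_, ?_⟩
  · intro p q
    simp only [hRt]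
    by_cases h : p ∈ TN Λ N ∧ q ∈ TN Λ N
    · rw [dif_pos h, dif_pos h.symm, hRs]
    · rw [dif_neg h, dif_neg (fun h' => h h'.symm)]
  · intro p q hp hq
    have hpT := hmemT p (by linarith)
    have hqT := hmemT q hq
    rw [KAct_eq_sum γ ω lam v W Λ N p hp (fun p' => Rt (p', q))]
    have h1 := hRe ⟨p, hpT⟩ ⟨q, hqT⟩
    have h2 : ∑ q' ∈ TN Λ N, (offK lam W Λ p q' +
        if p = q' then (2 * Real.pi * ω) * p.1 + γ * v p.2.1 else 0) * Rt (q', q) =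
        ∑ r, AMat (BN lam W Λ N) (fun p : TN Λ N => (2 * Real.pi * ω) * (p.1.1 : ℝ))
          (fun p => p.1.2) γ (fun j => v j.1) ⟨p, hpT⟩ r * R r ⟨q, hqT⟩ := by
      rw [← Finset.sum_coe_sort]
      refine Finset.sum_congr rfl fun r _ => ?_
      rw [← hval]
      congr 1
      simp only [AMat, BN, Matrix.add_apply, Matrix.of_apply, Matrix.diagonal_apply]
      congr 1
      simp only [Subtype.ext_iff]
    rw [h2]
    have h3 := hval ⟨p, hpT⟩ ⟨q, hqT⟩
    simp only at h3
    rw [h3, ← Complex.ofReal_mul, ← Complex.ofReal_sub, h1]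
    simp only [Subtype.mk.injEq]
    split_ifs <;> simp
  · intro F
    calc ∑ q ∈ F, Rt q ^ 2 ≤ ∑ q ∈ F ∪ (TN Λ N ×ˢ TN Λ N), Rt q ^ 2 :=
          Finset.sum_le_sum_of_subset_of_nonneg Finset.subset_union_left
            fun _ _ _ => sq_nonneg _
      _ = ∑ q ∈ TN Λ N ×ˢ TN Λ N, Rt q ^ 2 := by
          symm
          apply Finset.sum_subset Finset.subset_union_right
          intro q _ hq
          rw [hz q hq]; norm_num
      _ = ∑ p : TN Λ N, ∑ q : TN Λ N, R q p ^ 2 := by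
          rw [Finset.sum_product, ← Finset.sum_coe_sort]
          refine Finset.sum_congr rfl fun p _ => ?_
          rw [← Finset.sum_coe_sort]
          refine Finset.sum_congr rfl fun q _ => ?_
          rw [hval, hRs]
      _ ≤ ∑ p : TN Λ N, 5 * ((Λ.card + lam + γ) / ε) ^ 2 *
            (1 / (1 + (E - (2 * Real.pi * ω) * (p.1.1 : ℝ)) ^ 2)) :=
          Finset.sum_le_sum fun p _ => hRb p
      _ = 5 * ((Λ.card + lam + γ) / ε) ^ 2 *
            ∑ p ∈ TN Λ N, (1 / (1 + (E - (2 * Real.pi * ω) * (p.1 : ℝ)) ^ 2)) := by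
          rw [← Finset.mul_sum]
          congr 1
          exact Finset.sum_coe_sort (TN Λ N)
            (fun p => (1 / (1 + (E - (2 * Real.pi * ω) * (p.1 : ℝ)) ^ 2)))
      _ = 5 * ((Λ.card + lam + γ) / ε) ^ 2 * (Λ.card *
            ∑ n ∈ Finset.Icc (-(N : ℤ)) N, (1 / (1 + (E - (2 * Real.pi * ω) * (n : ℝ)) ^ 2))) := by
          rw [TN, Finset.sum_product]
          simp only [Finset.sum_const, nsmul_eq_mul, Finset.card_univ, Fintype.card_coe]
          rw [← Finset.mul_sum]
      _ ≤ _ := by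
          have := hS (Finset.Icc (-(N : ℤ)) N)
          gcongr

lemma gap_prob {d : ℕ} (g : Measure ℝ) (hg : NiceDisorder g) (Cg : ℝ≥0)
    (hC : ∀ A : Set ℝ, g A ≤ (Cg : ℝ≥0∞) * volume A) (P : Measure (Site d → ℝ))
    (hP : IsProductMeasure g P) (γ ω lam : ℝ) (hω : 0 < ω) (hγ : 1 ≤ γ) (hlam : 0 ≤ lam)
    (W : Site d → ℝ) (hW : ∀ j, |W j| ≤ 1) (Λ : Finset (Site d)) (E ε : ℝ) (N : ℕ)
    (hε : 0 < ε) (hε1 : 2 * ε ≤ 1) :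
    P {v | ¬ ((∀ j ∈ Λ, v j ∈ Set.Icc (-1 : ℝ) 1) ∧
        GapN γ ω lam W Λ E ε N (fun j => v j.1))} ≤
      ENNReal.ofReal (Λ.card * (Cg * (2 * ε / γ) *
        (Λ.card * (2 * (Λ.card + lam + 2 * γ) / (2 * Real.pi * ω) + 1)))) := by
  have hc : 0 < 2 * Real.pi * ω := by positivity
  have hn0 : (0 : ℝ) ≤ Λ.card := Nat.cast_nonneg _
  obtain ⟨S, hSm, hSP, hSg⟩ := wegner g hg Cg hC (BN lam W Λ N) (BN_herm lam W Λ N)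
    (fun p : TN Λ N => (2 * Real.pi * ω) * (p.1.1 : ℝ)) (fun p => p.1.2) γ (by linarith)
    E (Λ.card + lam) ε (Λ.card * (2 * (Λ.card + lam + 2 * γ) / (2 * Real.pi * ω) + 1))
    hε (by linarith) (BN_row lam hlam W hW Λ N) (by linarith) (by
      set a := E + ε - (Λ.card + lam + 2 * γ) with ha
      set b := E + ε + (Λ.card + lam + 2 * γ) with hb
      have h1 := lattice_count (2 * Real.pi * ω) hc a b (by rw [ha, hb]; linarith)
        (Finset.Icc (-(N : ℤ)) N)
      have h2 : (Finset.univ.filter fun p : TN Λ N => a ≤ 2 * Real.pi * ω * (p.1.1 : ℝ) ∧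
          2 * Real.pi * ω * (p.1.1 : ℝ) < b).card ≤
          (((Finset.Icc (-(N : ℤ)) N).filter fun n : ℤ => a ≤ 2 * Real.pi * ω * n ∧
            2 * Real.pi * ω * n < b) ×ˢ (Finset.univ : Finset Λ)).card := by
        apply Finset.card_le_card_of_injOn (fun p => p.1)
        · intro p hp
          have hp' := (Finset.mem_filter.1 hp).2
          have hpT := Finset.mem_product.1 p.2
          simp only [Finset.coe_product, Set.mem_prod, Finset.mem_coe, Finset.mem_filter,
            Finset.mem_univ, and_true]
          exact ⟨hpT.1, hp'⟩
        · exact Subtype.val_injective.injOn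
      rw [Finset.card_product, Finset.card_univ, Fintype.card_coe] at h2
      have h3 : b - a = 2 * (Λ.card + lam + 2 * γ) := by rw [ha, hb]; ring
      rw [h3] at h1
      calc _ ≤ ((((Finset.Icc (-(N : ℤ)) N).filter fun n : ℤ => a ≤ 2 * Real.pi * ω * n ∧
            2 * Real.pi * ω * n < b).card * Λ.card : ℕ) : ℝ) := by exact_mod_cast h2
        _ ≤ _ := by
            push_cast
            rw [mul_comm]
            exact mul_le_mul_of_nonneg_left h1 hn0)
  have hsub : {v : Site d → ℝ | ¬ ((∀ j ∈ Λ, v j ∈ Set.Icc (-1 : ℝ) 1) ∧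
        GapN γ ω lam W Λ E ε N (fun j => v j.1))} ⊆
      {v | ¬ ∀ j ∈ Λ, v j ∈ Set.Icc (-1 : ℝ) 1} ∪ (fun v (j : Λ) => v j.1) ⁻¹' S := by
    intro v hv
    by_cases h1 : ∀ j ∈ Λ, v j ∈ Set.Icc (-1 : ℝ) 1
    · right
      by_contra h2
      exact hv ⟨h1, hSg _ (fun j => h1 j.1 j.2) h2⟩
    · exact Or.inl h1
  refine (measure_mono hsub).trans ((measure_union_le _ _).trans ?_)
  rw [aux_supp g hg P hP Λ, zero_add, ← Measure.map_apply (by fun_prop) hSm,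
    aux_map g hg P hP Λ]
  simpa using hSP

lemma cube_card {d : ℕ} (hd : 1 ≤ d) (L : ℕ) (i : Site d) : L + 1 ≤ (cube (L : ℝ) i).card := by
  unfold cube
  rw [Finset.card_image_of_injective _ (add_left_injective i), Fintype.card_piFinset]
  simp only [Int.floor_natCast, Int.card_Icc, Finset.prod_const, Finset.card_univ,
    Fintype.card_fin]
  have : ((L : ℤ) + 1 - -(L : ℤ)).toNat = 2 * L + 1 := by omega
  rw [this]
  calc L + 1 ≤ 2 * L + 1 := by omega
    _ ≤ (2 * L + 1) ^ d := Nat.le_self_pow (by omega) _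

set_option maxHeartbeats 1000000 in
/-- **Hilbert–Schmidt bound on the resolvent of `K_Λ`.** Fix `p > 2d`. There exist
`s > 0` (depending on `p`) and `C > 0` such that for all sufficiently large `γ`, every
finite cube `Λ = ([-L,L]^d ∩ ℤ^d) + i` and every `E ∈ ℝ`, with probability at least
`1 - L^{-p}`, the resolvent `(E - K_Λ)⁻¹` exists and is Hilbert–Schmidt with
`‖(E - K_Λ)⁻¹‖_{HS} ≤ C·|Λ|^s·λ·(2d+γ)/ω`. -/
theorem hilbert_schmidt_resolvent_KLambda (d : ℕ) (hd : 1 ≤ d) (g : Measure ℝ)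
    (hg : NiceDisorder g) (P : Measure (Site d → ℝ)) (hP : IsProductMeasure g P)
    (ω : ℝ) (hω : 0 < ω) (lam : ℝ) (hlam : 0 < lam) (p : ℝ) (hp : 2 * d < p) :
    ∃ s > (0:ℝ), ∃ C > (0:ℝ), ∃ γ₀ : ℝ, ∀ γ : ℝ, γ₀ < γ →
      ∀ b : ℝ, 0 < b →
      ∀ W : Site d → ℝ, (∀ j, |W j| ≤ Real.exp (-(b * Real.log γ) * (l1 j : ℝ))) →
      ∀ (L : ℕ), 0 < L → ∀ (i : Site d) (E : ℝ),
        1 - ENNReal.ofReal ((L : ℝ) ^ (-p)) ≤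
          P {v | ∃ R : (ℤ × (cube (L : ℝ) i)) → (ℤ × (cube (L : ℝ) i)) → ℂ,
            IsGreenK γ ω lam v W (cube (L : ℝ) i) E R ∧
            Summable (fun q : (ℤ × (cube (L : ℝ) i)) × (ℤ × (cube (L : ℝ) i)) =>
              ‖R q.1 q.2‖ ^ 2) ∧
            Real.sqrt (∑' q : (ℤ × (cube (L : ℝ) i)) × (ℤ × (cube (L : ℝ) i)),
                ‖R q.1 q.2‖ ^ 2) ≤
              C * ((cube (L : ℝ) i).card : ℝ) ^ s * lam * (2 * d + γ) / ω} := by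
  obtain ⟨Cg, hC⟩ := hg.2.2
  have hc : 0 < 2 * Real.pi * ω := by positivity
  obtain ⟨S, hS0, hS⟩ := lattice_sum (2 * Real.pi * ω) hc
  have hp0 : 0 < p := lt_of_le_of_lt (by positivity) hp
  have hpi := Real.pi_pos
  have hCg0 : (0 : ℝ) ≤ Cg := Cg.coe_nonneg
  set κ : ℝ := (lam + 3) / (Real.pi * ω) + 1 with hκ
  have hκ1 : 1 ≤ κ := by
    have : 0 ≤ (lam + 3) / (Real.pi * ω) := by positivity
    linarith
  set C' : ℝ := Real.sqrt (5 * S) * ((2 + lam) * (2 * (Cg + 1) * κ)) with hC'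
  have hC'0 : 0 < C' := by
    have : 0 < Real.sqrt (5 * S) := Real.sqrt_pos.2 (by positivity)
    positivity
  refine ⟨5 + p, by linarith, C' * ω / lam, by positivity, 1, ?_⟩
  intro γ hγ b hb W hW L hL i E
  have hW1 : ∀ j, |W j| ≤ 1 := by
    intro j
    refine (hW j).trans (Real.exp_le_one_iff.2 ?_)
    have h1 : 0 ≤ Real.log γ := Real.log_nonneg hγ.le
    have h2 : 0 ≤ b * Real.log γ * (l1 j : ℝ) := by positivity
    linarith
  set Λ := cube (L : ℝ) i with hΛ
  have hcard : L + 1 ≤ Λ.card := cube_card hd L i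
  set n : ℝ := (Λ.card : ℝ) with hn
  have hLn : (L : ℝ) ≤ n := by rw [hn]; exact_mod_cast (by omega : L ≤ Λ.card)
  have hn1 : 1 ≤ n := by rw [hn]; exact_mod_cast (by omega : 1 ≤ Λ.card)
  have hn0 : 0 < n := by linarith
  have hL0 : (0 : ℝ) < L := by exact_mod_cast hL
  set Y : ℝ := n ^ p with hY
  have hY1 : 1 ≤ Y := Real.one_le_rpow hn1 hp0.le
  have hY0 : 0 < Y := by linarith
  set Q : ℝ := 2 * (Cg + 1) * κ * n ^ 3 * Y with hQ
  have hn3 : 1 ≤ n ^ 3 := one_le_pow₀ hn1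
  have hQ2 : 2 ≤ Q := by
    have h1 : 1 ≤ (Cg + 1 : ℝ) * κ := one_le_mul_of_one_le_of_one_le (by linarith) hκ1
    have h2 := one_le_mul_of_one_le_of_one_le h1 hn3
    have h3 := one_le_mul_of_one_le_of_one_le h2 hY1
    calc (2 : ℝ) ≤ 2 * (((Cg + 1 : ℝ) * κ) * n ^ 3 * Y) := by linarith
      _ = Q := by rw [hQ]; ring
  have hQ0 : 0 < Q := by linarith
  set ε : ℝ := 1 / Q with hε
  have hε0 : 0 < ε := by positivity
  have hε2 : 2 * ε ≤ 1 := by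
    rw [hε, mul_one_div, div_le_one hQ0]; exact hQ2
  have hγ0 : 0 < γ := by linarith
  have hnγ : n ≤ n * γ := le_mul_of_one_le_right hn0.le hγ.le
  have hγn : γ ≤ n * γ := le_mul_of_one_le_left hγ0.le hn1
  have h1nγ : 1 ≤ n * γ := by linarith
  -- probability bound for every truncation
  have hprob : ∀ N : ℕ, P {v | ¬ ((∀ j ∈ Λ, v j ∈ Set.Icc (-1 : ℝ) 1) ∧
      GapN γ ω lam W Λ E ε N (fun j => v j.1))} ≤ ENNReal.ofReal ((L : ℝ) ^ (-p)) := by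
    intro N
    refine (gap_prob g hg Cg hC P hP γ ω lam hω hγ.le hlam.le W hW1 Λ E ε N hε0 hε2).trans ?_
    apply ENNReal.ofReal_le_ofReal
    have e1 : 2 * (n + lam + 2 * γ) / (2 * Real.pi * ω) + 1 ≤ n * γ * κ := by
      have : 2 * (n + lam + 2 * γ) / (2 * Real.pi * ω) = (n + lam + 2 * γ) / (Real.pi * ω) := by
        rw [mul_assoc, mul_div_mul_left _ _ two_ne_zero]
      rw [this, hκ, mul_add, mul_one, ← mul_div_assoc]
      refine add_le_add ?_ h1nγ
      gcongr
      have : lam ≤ lam * (n * γ) := le_mul_of_one_le_right hlam.le h1nγ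
      linarith [mul_add (n * γ) lam 3, mul_comm lam (n * γ)]
    calc n * (Cg * (2 * ε / γ) * (n * (2 * (n + lam + 2 * γ) / (2 * Real.pi * ω) + 1)))
        ≤ n * ((Cg + 1) * (2 * ε / γ) * (n * (n * γ * κ))) := by
          gcongr
          linarith
      _ = (2 * (Cg + 1) * κ * n ^ 3) * ε := by field_simp
      _ = Y⁻¹ := by
          have hκ0 : 0 < κ := by linarith
          have hCg1 : (0 : ℝ) < Cg + 1 := by linarith
          rw [hε, hQ]; field_simp
      _ = n ^ (-p) := by rw [hY, Real.rpow_neg hn0.le]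
      _ ≤ (L : ℝ) ^ (-p) := Real.rpow_le_rpow_of_nonpos hL0 hLn (by linarith)
  -- Hilbert-Schmidt bound
  have hHS : Real.sqrt (5 * ((n + lam + γ) / ε) ^ 2 * (n * S)) ≤
      C' * ω / lam * n ^ (5 + p) * lam * (2 * d + γ) / ω := by
    have hpow : n ^ (5 + p) = n ^ 5 * Y := by
      rw [Real.rpow_add hn0, hY]
      congr 1
      exact_mod_cast Real.rpow_natCast n 5
    have e0 : C' * ω / lam * n ^ (5 + p) * lam * (2 * d + γ) / ω =
        C' * (n ^ 5 * Y) * (2 * d + γ) := by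
      rw [hpow]; field_simp
    have e1 : n + lam + γ ≤ n * γ * (2 + lam) := by
      have : lam ≤ lam * (n * γ) := le_mul_of_one_le_right hlam.le h1nγ
      linarith [mul_add (n * γ) 2 lam, mul_comm lam (n * γ)]
    have e2 : (n + lam + γ) / ε = (n + lam + γ) * Q := by rw [hε]; field_simp
    rw [e0]
    have e3 : 5 * ((n + lam + γ) / ε) ^ 2 * (n * S) ≤
        (Real.sqrt (5 * S) * (n * (n * γ * (2 + lam) * Q))) ^ 2 := by
      rw [e2, mul_pow (Real.sqrt (5 * S)), Real.sq_sqrt (by positivity), mul_pow n]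
      have h1 : ((n + lam + γ) * Q) ^ 2 ≤ (n * γ * (2 + lam) * Q) ^ 2 := by gcongr
      have h2 : n ≤ n ^ 2 := le_self_pow₀ (by assumption) two_ne_zero
      calc 5 * ((n + lam + γ) * Q) ^ 2 * (n * S)
          ≤ 5 * (n * γ * (2 + lam) * Q) ^ 2 * (n ^ 2 * S) := by gcongr
        _ = _ := by ring
    refine (Real.sqrt_le_sqrt e3).trans ?_
    rw [Real.sqrt_sq (by positivity)]
    calc Real.sqrt (5 * S) * (n * (n * γ * (2 + lam) * Q)) = C' * (n ^ 5 * Y) * γ := by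
          rw [hC', hQ]; ring
      _ ≤ _ := by
          have : (0 : ℝ) ≤ 2 * d := by positivity
          gcongr
          linarith
  have := hP.1
  set G : Set (Site d → ℝ) := {v | ∃ R : (ℤ × Λ) → (ℤ × Λ) → ℂ,
            IsGreenK γ ω lam v W Λ E R ∧
            Summable (fun q : (ℤ × Λ) × (ℤ × Λ) => ‖R q.1 q.2‖ ^ 2) ∧
            Real.sqrt (∑' q : (ℤ × Λ) × (ℤ × Λ), ‖R q.1 q.2‖ ^ 2) ≤
              C' * ω / lam * n ^ (5 + p) * lam * (2 * d + γ) / ω} with hG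
  have hsub : Gᶜ ⊆ ⋃ N0 : ℕ, ⋂ N ≥ N0, {v | ¬ ((∀ j ∈ Λ, v j ∈ Set.Icc (-1 : ℝ) 1) ∧
      GapN γ ω lam W Λ E ε N (fun j => v j.1))} := by
    intro v hv
    by_contra hcon
    apply hv
    have hfreq : ∃ᶠ N : ℕ in Filter.atTop, ((∀ j ∈ Λ, v j ∈ Set.Icc (-1 : ℝ) 1) ∧
        GapN γ ω lam W Λ E ε N (fun j => v j.1)) := by
      intro hev
      apply hcon
      obtain ⟨N0, hN0⟩ := Filter.eventually_atTop.1 hev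
      exact Set.mem_iUnion.2 ⟨N0, Set.mem_iInter₂.2 fun N hN => hN0 N hN⟩
    obtain ⟨R, h1, h2, h3⟩ := green_limit γ ω lam v W Λ E
      (5 * ((Λ.card + lam + γ) / ε) ^ 2 * (Λ.card * S)) (hfreq.mono fun N hN =>
        approx_of_gap γ ω lam hγ.le hlam.le v W hW1 Λ E ε S N hε0 (by linarith) hN.1 (hS E) hN.2)
    exact ⟨R, h1, h2, (Real.sqrt_le_sqrt h3).trans hHS⟩
  have hbad : P Gᶜ ≤ ENNReal.ofReal ((L : ℝ) ^ (-p)) := by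
    refine (measure_mono hsub).trans ?_
    rw [Monotone.measure_iUnion]
    · refine iSup_le fun N0 => ?_
      exact (measure_mono (Set.iInter₂_subset N0 le_rfl)).trans (hprob N0)
    · intro N0 N1 h01 v hv
      rw [Set.mem_iInter₂] at hv ⊢
      exact fun N hN => hv N (le_trans h01 hN)
  have huniv : 1 ≤ P G + P Gᶜ := by
    rw [← measure_univ (μ := P), ← Set.union_compl_self G]
    exact measure_union_le _ _
  change 1 - ENNReal.ofReal ((L : ℝ) ^ (-p)) ≤ P G
  rw [tsub_le_iff_right]
  exact huniv.trans (add_le_add le_rfl hbad)
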